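/- arXiv:2507.16105 — 2 statements merged into one kernel-verified Lean document; each statement's English description precedes it below -/
import Mathlib

section
/- There exist c > 0 and N such that for all n ≥ N: every monotone circuit computing Odd_n has size at least 2^(n^c). -/
/-- A monotone circuit (straight-line program) with input bits indexed by `ι`:
gate `i` is either an input variable, or the AND (`true`) / OR (`false`) of two
earlier gates. Its size is the number of gates. -/
structure MonCircuit (ι : Type) where
  size : ℕ
  gate : (i : Fin size) → ι ⊕ (Bool × Fin i.val × Fin i.val)

/-- Evaluation of the gates of a monotone circuit on input `x`. -/
def MonCircuit.eval {ι : Type} (C : MonCircuit ι) (x : ι → Bool) : (i : Fin C.size) → Bool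
  | i =>
    match C.gate i with
    | Sum.inl j => x j
    | Sum.inr (op, j, k) =>
      let a := C.eval x ⟨j.val, j.isLt.trans i.isLt⟩
      let b := C.eval x ⟨k.val, k.isLt.trans i.isLt⟩
      if op then a && b else a || b
  termination_by i => i.val

/-- `C` computes the boolean function `f` (given as a predicate on inputs):
the circuit is nonempty and its last gate outputs `true` exactly on inputs satisfying `f`. -/
def MonCircuit.Computes {ι : Type} (C : MonCircuit ι) (f : (ι → Bool) → Prop) : Prop :=
  ∃ h : 0 < C.size, ∀ x : ι → Bool,
    (C.eval x ⟨C.size - 1, Nat.sub_lt h Nat.one_pos⟩ = true ↔ f x)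

/-- A matching in `K_{n,n}`: a set of edges with pairwise distinct left endpoints
and pairwise distinct right endpoints. -/
def IsMatching {n : ℕ} (M : Finset (Fin n × Fin n)) : Prop :=
  ∀ e ∈ M, ∀ e' ∈ M, e ≠ e' → e.1 ≠ e'.1 ∧ e.2 ≠ e'.2

/-- `Odd n x = 1` iff the bipartite graph `x ⊆ L × R` has a subgraph `y` in which every one
of the `2n` vertices (left `u : Fin n` and right `v : Fin n`) has odd degree. -/
def OddFactorProp (n : ℕ) (x : Fin n × Fin n → Bool) : Prop :=
  ∃ y : Finset (Fin n × Fin n), (∀ e ∈ y, x e = true) ∧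
    (∀ u : Fin n, Odd (y.filter (fun e => e.1 = u)).card) ∧
    (∀ v : Fin n, Odd (y.filter (fun e => e.2 = v)).card)

open Finset

section Counting

variable {V Q ι : Type*} [DecidableEq V]

/-- Summing a geometric weight of the intersection size over a spread family. -/
lemma sum_pow_card_inter_le (J : Finset ι) (D : ι → Finset V) (m N ρ : ℕ) (hN : 0 < N)
    (hρ : 4 * m * N ≤ ρ) (hρ0 : 0 < ρ)
    (hspread : ∀ A : Finset V, #{j ∈ J | A ⊆ D j} * ρ ^ #A ≤ 2 * #J)
    (E : Finset V) (hE : #E = m) :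
    ∑ j ∈ J, (N : ℝ) ^ #(E ∩ D j) ≤ 2 * #J := by
  have hN1 : (1 : ℝ) ≤ N := by exact_mod_cast hN
  have hρR : (0 : ℝ) < ρ := by exact_mod_cast hρ0
  set x : ℝ := (N - 1) / ρ with hx
  have hx0 : 0 ≤ x := div_nonneg (by linarith) hρR.le
  have expand : ∀ j, (N : ℝ) ^ #(E ∩ D j) =
      ∑ A ∈ E.powerset, if A ⊆ D j then ((N : ℝ) - 1) ^ #A else 0 := by
    intro j
    have h := Finset.sum_pow_mul_eq_add_pow ((N : ℝ) - 1) 1 (E ∩ D j)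
    simp only [one_pow, mul_one, sub_add_cancel] at h
    rw [← h, ← sum_filter]
    refine sum_congr ?_ fun _ _ => rfl
    ext A
    simp only [mem_powerset, mem_filter, subset_inter_iff]
  have term : ∀ A : Finset V, ((N : ℝ) - 1) ^ #A * #{j ∈ J | A ⊆ D j} ≤
      2 * #J * x ^ #A - if A = ∅ then (#J : ℝ) else 0 := by
    intro A
    split_ifs with hA
    · subst hA
      simp
      linarith
    · have h : (#{j ∈ J | A ⊆ D j} : ℝ) * (ρ : ℝ) ^ #A ≤ 2 * #J := by exact_mod_cast hspread A
      have h2 : (#{j ∈ J | A ⊆ D j} : ℝ) ≤ 2 * #J / (ρ : ℝ) ^ #A := by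
        rwa [le_div_iff₀ (by positivity)]
      calc ((N : ℝ) - 1) ^ #A * #{j ∈ J | A ⊆ D j}
          ≤ ((N : ℝ) - 1) ^ #A * (2 * #J / (ρ : ℝ) ^ #A) := by
            gcongr
        _ = 2 * #J * x ^ #A - 0 := by rw [hx, div_pow]; ring
  have hy : (x + 1) ^ m ≤ 4 / 3 := by
    have hmx : m * x ≤ 1 / 4 := by
      rw [hx, ← mul_div_assoc, div_le_iff₀ hρR]
      have : (4 : ℝ) * m * N ≤ ρ := by exact_mod_cast hρ
      have : (0 : ℝ) ≤ m := by positivity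
      nlinarith
    calc (x + 1) ^ m ≤ Real.exp x ^ m := by gcongr; exact Real.add_one_le_exp x
      _ = Real.exp (m * x) := by rw [Real.exp_nat_mul]
      _ ≤ Real.exp (1 / 4) := Real.exp_le_exp.2 hmx
      _ ≤ 1 / (1 - 1 / 4) := Real.exp_bound_div_one_sub_of_interval (by norm_num) (by norm_num)
      _ = 4 / 3 := by norm_num
  calc ∑ j ∈ J, (N : ℝ) ^ #(E ∩ D j)
      = ∑ A ∈ E.powerset, ((N : ℝ) - 1) ^ #A * #{j ∈ J | A ⊆ D j} := by
        simp only [expand]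
        rw [sum_comm]
        refine sum_congr rfl fun A _ => ?_
        rw [← sum_filter, sum_const, nsmul_eq_mul, mul_comm]
    _ ≤ ∑ A ∈ E.powerset, (2 * #J * x ^ #A - if A = ∅ then (#J : ℝ) else 0) :=
        sum_le_sum fun A _ => term A
    _ = 2 * #J * (x + 1) ^ m - #J := by
        rw [sum_sub_distrib, ← mul_sum, sum_ite_eq' E.powerset ∅, if_pos (empty_mem_powerset E)]
        have h := Finset.sum_pow_mul_eq_add_pow x 1 E
        simp only [one_pow, mul_one, hE] at h
        rw [h]
    _ ≤ 2 * #J := by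
        have : (0 : ℝ) ≤ #J := by positivity
        nlinarith

variable [Fintype V] [Fintype Q]

/-- Events depending on complementary sets of coordinates are independent. -/
lemma card_filter_and_mul_le (U : V → Prop) [DecidablePred U] (p q : (V → Q) → Prop)
    [DecidablePred p] [DecidablePred q]
    (hp : ∀ s s', (∀ v, U v → s v = s' v) → p s → p s')
    (hq : ∀ s s', (∀ v, ¬ U v → s v = s' v) → q s → q s') :
    #{s : V → Q | p s ∧ q s} * Fintype.card Q ^ Fintype.card V ≤
      #{s : V → Q | p s} * #{s : V → Q | q s} := by
  rw [← Fintype.card_fun, ← card_univ (α := V → Q), ← card_product, ← card_product]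
  let mix : (V → Q) → (V → Q) → V → Q := fun s s' v => if U v then s v else s' v
  refine card_le_card_of_injOn (fun z => (mix z.1 z.2, mix z.2 z.1)) ?_ ?_
  · rintro ⟨s, s'⟩ hs
    simp only [coe_product, coe_filter, coe_univ, Set.mem_prod, mem_univ, true_and,
      Set.mem_ofPred_eq, Set.mem_univ, and_true] at hs ⊢
    exact ⟨hp s _ (fun v hv => by simp [mix, hv]) hs.1,
      hq s _ (fun v hv => by simp [mix, hv]) hs.2⟩
  · rintro ⟨s, s'⟩ _ ⟨r, r'⟩ _ h
    simp only [Prod.mk.injEq] at h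
    have h1 := fun v => congrFun h.1 v
    have h2 := fun v => congrFun h.2 v
    simp only [mix] at h1 h2
    refine Prod.ext (funext fun v => ?_) (funext fun v => ?_) <;>
    · have h1 := h1 v
      have h2 := h2 v
      by_cases hv : U v <;> simp_all

/-- Events depending on the different fibres of `π` are independent. -/
lemma card_filter_forall_mul_le {κ : Type*} [DecidableEq κ] (π : V → κ)
    (p : κ → (V → Q) → Prop) [∀ i, DecidablePred (p i)]
    (hp : ∀ i s s', (∀ v, π v = i → s v = s' v) → p i s → p i s') (I : Finset κ) :
    #{s : V → Q | ∀ i ∈ I, p i s} * (Fintype.card Q ^ Fintype.card V) ^ #I ≤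
      Fintype.card Q ^ Fintype.card V * ∏ i ∈ I, #{s : V → Q | p i s} := by
  induction I using Finset.induction_on with
  | empty => simp
  | insert a I ha ih =>
    rw [card_insert_of_notMem ha, prod_insert ha]
    simp only [forall_mem_insert]
    have h := card_filter_and_mul_le (fun v => π v = a) (p a) (fun s => ∀ i ∈ I, p i s) (hp a)
      (fun s s' hss h i hi => hp i s s'
        (fun v hv => hss v fun hva => ha (by rwa [← hva, hv])) (h i hi))
    calc _ = #{s : V → Q | p a s ∧ ∀ i ∈ I, p i s} * Fintype.card Q ^ Fintype.card V *
          (Fintype.card Q ^ Fintype.card V) ^ #I := by ring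
      _ ≤ #{s : V → Q | p a s} * #{s : V → Q | ∀ i ∈ I, p i s} *
          (Fintype.card Q ^ Fintype.card V) ^ #I := Nat.mul_le_mul_right _ h
      _ = #{s : V → Q | p a s} * (#{s : V → Q | ∀ i ∈ I, p i s} *
          (Fintype.card Q ^ Fintype.card V) ^ #I) := by ring
      _ ≤ #{s : V → Q | p a s} *
          (Fintype.card Q ^ Fintype.card V * ∏ i ∈ I, #{s : V → Q | p i s}) :=
        Nat.mul_le_mul_left _ ih
      _ = _ := by ring

variable [DecidableEq Q]

/-- The number of functions agreeing with `t` on `D`. -/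
lemma card_agree_on (D : Finset V) (t : V → Q) :
    #{s : V → Q | ∀ v ∈ D, s v = t v} * Fintype.card Q ^ #D =
      Fintype.card Q ^ Fintype.card V := by
  have h : ({s : V → Q | ∀ v ∈ D, s v = t v} : Finset (V → Q)) =
      Fintype.piFinset (fun v => if v ∈ D then {t v} else univ) := by
    ext s
    simp only [mem_filter, mem_univ, true_and, Fintype.mem_piFinset]
    refine forall_congr' fun v => ?_
    by_cases hv : v ∈ D <;> simp [hv]
  rw [h, Fintype.card_piFinset]
  have h2 : ∀ v, #(if v ∈ D then {t v} else (univ : Finset Q)) =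
      if v ∈ D then 1 else Fintype.card Q := by
    intro v; split_ifs <;> simp
  simp only [h2]
  rw [Finset.prod_ite]
  simp only [prod_const_one, one_mul, prod_const]
  rw [← pow_add, ← card_univ (α := V), ← card_filter_add_card_filter_not (s := univ) (· ∈ D),
    add_comm]
  simp

/-- The number of functions agreeing with two given functions on two given sets. -/
lemma card_agree_on_pair_le (D D' : Finset V) (t t' : V → Q) :
    #{s : V → Q | (∀ v ∈ D, s v = t v) ∧ ∀ v ∈ D', s v = t' v} * Fintype.card Q ^ #(D ∪ D') ≤
      Fintype.card Q ^ Fintype.card V := by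
  rw [← card_agree_on (D ∪ D') (fun v => if v ∈ D then t v else t' v)]
  gcongr with s hs
  rintro ⟨h1, h2⟩ v hv
  split_ifs with h
  · exact h1 v h
  · exact h2 v ((mem_union.1 hv).resolve_left h)

/-- Second moment bound: if the cubes `{s | s = t j on D j}` come from a spread family of domains
of equal size, then at least half of all functions lie in one of them. -/
lemma two_mul_card_avoid_le (J : Finset ι) (D : ι → Finset V) (t : ι → V → Q) (m ρ : ℕ)
    (hJ : J.Nonempty) (hm : ∀ j ∈ J, #(D j) = m) (hQ : 0 < Fintype.card Q)
    (hρ : 4 * m * Fintype.card Q ≤ ρ) (hρ0 : 0 < ρ)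
    (hspread : ∀ A : Finset V, #{j ∈ J | A ⊆ D j} * ρ ^ #A ≤ 2 * #J) :
    2 * #{s : V → Q | ∀ j ∈ J, ¬ ∀ v ∈ D j, s v = t j v} ≤
      Fintype.card Q ^ Fintype.card V := by
  set N := Fintype.card Q with hN
  have hNR : (0 : ℝ) < N := by exact_mod_cast hQ
  set W : ℝ := (N : ℝ) ^ Fintype.card V with hW
  have hW0 : 0 < W := by positivity
  have hJ0 : (0 : ℝ) < #J := by exact_mod_cast hJ.card_pos
  let X : (V → Q) → ℝ := fun s => ∑ j ∈ J, if ∀ v ∈ D j, s v = t j v then 1 else 0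
  let G : Finset (V → Q) := {s | ¬ ∀ j ∈ J, ¬ ∀ v ∈ D j, s v = t j v}
  have hX0 : ∀ s, s ∉ G → X s = 0 := by
    intro s hs
    simp only [G, mem_filter, mem_univ, true_and, not_not] at hs
    exact sum_eq_zero fun j hj => if_neg (hs j hj)
  have first : ∑ s, X s = #J * (W / (N : ℝ) ^ m) := by
    simp only [X]
    rw [sum_comm, ← nsmul_eq_mul, ← sum_const]
    refine sum_congr rfl fun j hj => ?_
    rw [← sum_filter, sum_const, nsmul_eq_mul, mul_one, eq_div_iff (by positivity), ← hm j hj]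
    rw [hW]
    exact_mod_cast card_agree_on (D j) (t j)
  have pair : ∀ j ∈ J, ∀ k ∈ J,
      (#{s : V → Q | (∀ v ∈ D j, s v = t j v) ∧ ∀ v ∈ D k, s v = t k v} : ℝ) ≤
        W / ((N : ℝ) ^ m) ^ 2 * (N : ℝ) ^ #(D j ∩ D k) := by
    intro j hj k hk
    have h : (#{s : V → Q | (∀ v ∈ D j, s v = t j v) ∧ ∀ v ∈ D k, s v = t k v} : ℝ) *
        (N : ℝ) ^ #(D j ∪ D k) ≤ W := by
      rw [hW]
      exact_mod_cast card_agree_on_pair_le (D j) (D k) (t j) (t k)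
    have hc : (N : ℝ) ^ #(D j ∪ D k) * (N : ℝ) ^ #(D j ∩ D k) = ((N : ℝ) ^ m) ^ 2 := by
      rw [← pow_add, card_union_add_card_inter, hm j hj, hm k hk, ← pow_mul]
      ring
    rw [← hc]
    calc _ ≤ W / (N : ℝ) ^ #(D j ∪ D k) := by rwa [le_div_iff₀ (by positivity)]
      _ = _ := by field_simp
  have second : ∑ s, X s ^ 2 ≤ 2 * #J ^ 2 * (W / ((N : ℝ) ^ m) ^ 2) := by
    calc ∑ s, X s ^ 2
        = ∑ j ∈ J, ∑ k ∈ J,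
          (#{s : V → Q | (∀ v ∈ D j, s v = t j v) ∧ ∀ v ∈ D k, s v = t k v} : ℝ) := by
          simp only [X, sq, sum_mul_sum]
          rw [sum_comm]
          refine sum_congr rfl fun j _ => ?_
          rw [sum_comm]
          refine sum_congr rfl fun k _ => ?_
          rw [← sum_boole]
          refine sum_congr rfl fun s _ => ?_
          split_ifs <;> simp_all
      _ ≤ ∑ j ∈ J, ∑ k ∈ J, W / ((N : ℝ) ^ m) ^ 2 * (N : ℝ) ^ #(D j ∩ D k) :=
          sum_le_sum fun j hj => sum_le_sum fun k hk => pair j hj k hk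
      _ ≤ ∑ j ∈ J, W / ((N : ℝ) ^ m) ^ 2 * (2 * #J) := by
          refine sum_le_sum fun j hj => ?_
          rw [← mul_sum]
          gcongr
          exact sum_pow_card_inter_le J D m N ρ hQ hρ hρ0 hspread (D j) (hm j hj)
      _ = 2 * #J ^ 2 * (W / ((N : ℝ) ^ m) ^ 2) := by
          rw [sum_const, nsmul_eq_mul]; ring
  have cauchy : (∑ s, X s) ^ 2 ≤ #G * ∑ s, X s ^ 2 := by
    have h1 : ∑ s, X s = ∑ s ∈ G, X s :=
      (sum_subset (subset_univ G) fun s _ hs => hX0 s hs).symm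
    rw [h1]
    refine sq_sum_le_card_mul_sum_sq.trans ?_
    gcongr
    exact subset_univ G
  have hG : W ≤ 2 * #G := by
    rw [first] at cauchy
    have h := cauchy.trans (mul_le_mul_of_nonneg_left second (by positivity : (0 : ℝ) ≤ #G))
    have hP : 0 < #J ^ 2 * (W / ((N : ℝ) ^ m) ^ 2) := by positivity
    refine le_of_mul_le_mul_right ?_ hP
    calc W * (#J ^ 2 * (W / ((N : ℝ) ^ m) ^ 2)) = (#J * (W / (N : ℝ) ^ m)) ^ 2 := by ring
      _ ≤ _ := h
      _ = _ := by ring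
  have hsplit := card_filter_add_card_filter_not (s := (univ : Finset (V → Q)))
    (fun s => ∀ j ∈ J, ¬ ∀ v ∈ D j, s v = t j v)
  rw [card_univ, Fintype.card_fun, ← hN] at hsplit
  have hG' : N ^ Fintype.card V ≤ 2 * #G := by
    rw [hW] at hG
    exact_mod_cast hG
  change _ + #G = _ at hsplit
  omega

lemma prod_le_pow_of_sum_le {κ : Type*} (I : Finset κ) (f : κ → ℝ) (a : ℝ) (ha : 0 < a)
    (hf : ∀ i ∈ I, 0 ≤ f i) (h : ∑ i ∈ I, f i ≤ #I * a) : ∏ i ∈ I, f i ≤ a ^ #I := by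
  have h1 : ∏ i ∈ I, f i / a ≤ 1 := by
    calc ∏ i ∈ I, f i / a ≤ ∏ i ∈ I, Real.exp (f i / a - 1) := by
          refine prod_le_prod (fun i hi => div_nonneg (hf i hi) ha.le) fun i _ => ?_
          linarith [Real.add_one_le_exp (f i / a - 1)]
      _ = Real.exp (∑ i ∈ I, (f i / a - 1)) := (Real.exp_sum _ _).symm
      _ ≤ 1 := by
          rw [Real.exp_le_one_iff, sum_sub_distrib, ← sum_div]
          simp only [sum_const, nsmul_eq_mul, mul_one]
          rw [sub_nonpos, div_le_iff₀ ha]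
          exact h
  rwa [prod_div_distrib, prod_const, div_le_one (by positivity)] at h1

/-- Boosting of the second moment bound: all but a `2 ^ (-T)` fraction of the two-colourings lie
in one of the cubes of a spread family. The coordinates are split into `T` blocks in such a way
that the blocks give independent attempts, each failing with probability at most one half on
average. -/
lemma two_pow_mul_card_avoid_le (J : Finset ι) (D : ι → Finset V) (c : ι → V → Bool)
    (m ρ T : ℕ) (hJ : J.Nonempty) (hm : ∀ j ∈ J, #(D j) = m) (hT : 0 < T)
    (hρ : 4 * m * (2 * T) ≤ ρ) (hρ0 : 0 < ρ)
    (hspread : ∀ A : Finset V, #{j ∈ J | A ⊆ D j} * ρ ^ #A ≤ 2 * #J) :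
    2 ^ T * #{χ : V → Bool | ∀ j ∈ J, ¬ ∀ v ∈ D j, χ v = c j v} ≤ 2 ^ Fintype.card V := by
  let p : (V → Fin T) → Fin T → (V → Bool) → Prop :=
    fun π i χ => ∀ j ∈ J, ¬ ∀ v ∈ D j, π v = i ∧ χ v = c j v
  have hcard : Fintype.card (Fin T × Bool) = T * 2 := by simp
  have block : ∀ i : Fin T, 2 * ∑ π : V → Fin T, #{χ : V → Bool | p π i χ} ≤
      T ^ Fintype.card V * 2 ^ Fintype.card V := by
    intro i
    have h := two_mul_card_avoid_le J D (fun j v => (i, c j v)) m ρ hJ hm (by rw [hcard]; omega)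
      (by rw [hcard, mul_comm T]; exact hρ) hρ0 hspread
    rw [hcard, mul_pow] at h
    refine le_trans (Nat.mul_le_mul_left 2 ?_) h
    rw [← card_sigma]
    refine card_le_card_of_injOn (fun z v => (z.1 v, z.2 v)) ?_ ?_
    · rintro ⟨π, χ⟩ hz
      simpa [p, Prod.ext_iff] using hz
    · rintro ⟨π, χ⟩ _ ⟨π', χ'⟩ _ h
      have h' := fun v => congrFun h v
      simp only [Prod.mk.injEq] at h'
      have h1 : π = π' := funext fun v => (h' v).1
      have h2 : χ = χ' := funext fun v => (h' v).2
      rw [h1, h2]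
  obtain ⟨π, hπ⟩ : ∃ π : V → Fin T,
      2 * ∑ i, #{χ : V → Bool | p π i χ} ≤ T * 2 ^ Fintype.card V := by
    by_contra! hcon
    have hlt : ∑ π : V → Fin T, T * 2 ^ Fintype.card V <
        ∑ π : V → Fin T, 2 * ∑ i, #{χ : V → Bool | p π i χ} :=
      sum_lt_sum_of_nonempty ⟨fun _ => ⟨0, hT⟩, mem_univ _⟩ fun π _ => hcon π
    rw [sum_const, ← mul_sum, sum_comm, mul_sum] at hlt
    have hle := sum_le_sum fun i (_ : i ∈ (univ : Finset (Fin T))) => block i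
    simp only [sum_const, card_univ, Fintype.card_fun, Fintype.card_fin, smul_eq_mul] at hlt hle
    have : T ^ Fintype.card V * (T * 2 ^ Fintype.card V) =
      T * (T ^ Fintype.card V * 2 ^ Fintype.card V) := by ring
    omega
  have hind : #{χ : V → Bool | ∀ i ∈ univ, p π i χ} * (2 ^ Fintype.card V) ^ T ≤
      2 ^ Fintype.card V * ∏ i, #{χ : V → Bool | p π i χ} := by
    have h := card_filter_forall_mul_le π (p π)
      (fun i χ χ' hχ h j hj hall => h j hj fun v hv =>
        ⟨(hall v hv).1, (hχ v (hall v hv).1).trans (hall v hv).2⟩) univ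
    simp only [Fintype.card_bool, card_univ, Fintype.card_fin] at h
    convert h
  have hsub : #{χ : V → Bool | ∀ j ∈ J, ¬ ∀ v ∈ D j, χ v = c j v} ≤
      #{χ : V → Bool | ∀ i ∈ univ, p π i χ} := by
    refine card_le_card fun χ hχ => ?_
    simp only [mem_filter, mem_univ, true_and] at hχ ⊢
    exact fun i _ j hj hall => hχ j hj fun v hv => (hall v hv).2
  set W : ℝ := 2 ^ Fintype.card V with hW
  have hW0 : 0 < W := by positivity
  have hprod : ∏ i, (#{χ : V → Bool | p π i χ} : ℝ) ≤ (W / 2) ^ T := by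
    have h := prod_le_pow_of_sum_le univ (fun i => (#{χ : V → Bool | p π i χ} : ℝ)) (W / 2)
      (by positivity) (fun _ _ => by positivity) (by
        have : 2 * ∑ i, (#{χ : V → Bool | p π i χ} : ℝ) ≤ T * W := by
          rw [hW]
          exact_mod_cast hπ
        rw [card_univ, Fintype.card_fin]
        linarith)
    rwa [card_univ, Fintype.card_fin] at h
  have hindR : (#{χ : V → Bool | ∀ i ∈ univ, p π i χ} : ℝ) * W ^ T ≤
      W * ∏ i, (#{χ : V → Bool | p π i χ} : ℝ) := by
    rw [hW]
    exact_mod_cast hind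
  have hfin : (2 : ℝ) ^ T * #{χ : V → Bool | ∀ i ∈ univ, p π i χ} ≤ W := by
    have h := hindR.trans (mul_le_mul_of_nonneg_left hprod hW0.le)
    rw [div_pow, mul_div_assoc', le_div_iff₀ (by positivity)] at h
    refine le_of_mul_le_mul_right (a := W ^ T) ?_ (by positivity)
    linarith
  have hfin' : 2 ^ T * #{χ : V → Bool | ∀ i ∈ univ, p π i χ} ≤ 2 ^ Fintype.card V := by
    rw [hW] at hfin
    exact_mod_cast hfin
  exact (Nat.mul_le_mul_left _ hsub).trans hfin'

end Counting

section Matching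

variable {n : ℕ}

/-- The set of endpoints of a set of edges of `K_{n,n}`. -/
def endpoints (M : Finset (Fin n × Fin n)) : Finset (Fin n ⊕ Fin n) :=
  M.image (fun e => Sum.inl e.1) ∪ M.image (fun e => Sum.inr e.2)

/-- The graph of monochromatic edges of a two-colouring of the vertices of `K_{n,n}`. -/
def monoGraph (χ : Fin n ⊕ Fin n → Bool) (e : Fin n × Fin n) : Bool :=
  χ (Sum.inl e.1) == χ (Sum.inr e.2)

/-- The graph `x` contains a member of the family `F`. -/
def Accepts (F : Finset (Finset (Fin n × Fin n))) (x : Fin n × Fin n → Bool) : Prop :=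
  ∃ M ∈ F, ∀ e ∈ M, x e = true

instance (F : Finset (Finset (Fin n × Fin n))) : DecidablePred (Accepts F) :=
  fun _ => inferInstanceAs (Decidable (∃ _ ∈ _, _))

/-- The number of two-colourings whose graph of monochromatic edges, enlarged by `S`, contains no
member of `F`. -/
def rejectCount (F : Finset (Finset (Fin n × Fin n))) (S : Finset (Fin n × Fin n)) : ℕ :=
  #{χ : Fin n ⊕ Fin n → Bool | ¬ Accepts F (fun e => decide (e ∈ S) || monoGraph χ e)}

lemma inl_mem_endpoints {M : Finset (Fin n × Fin n)} {u : Fin n} :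
    Sum.inl u ∈ endpoints M ↔ ∃ v, (u, v) ∈ M := by
  simp [endpoints]

lemma inr_mem_endpoints {M : Finset (Fin n × Fin n)} {v : Fin n} :
    Sum.inr v ∈ endpoints M ↔ ∃ u, (u, v) ∈ M := by
  simp [endpoints]

lemma endpoints_mono {S M : Finset (Fin n × Fin n)} (h : S ⊆ M) : endpoints S ⊆ endpoints M :=
  union_subset_union (image_subset_image h) (image_subset_image h)

lemma endpoints_insert (e : Fin n × Fin n) (M : Finset (Fin n × Fin n)) :
    endpoints (insert e M) = {Sum.inl e.1, Sum.inr e.2} ∪ endpoints M := by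
  ext (u | v) <;> simp [endpoints]

lemma IsMatching.mono {S M : Finset (Fin n × Fin n)} (hM : IsMatching M) (h : S ⊆ M) :
    IsMatching S :=
  fun e he e' he' => hM e (h he) e' (h he')

lemma IsMatching.right_unique {M : Finset (Fin n × Fin n)} (hM : IsMatching M) {u v v' : Fin n}
    (h : (u, v) ∈ M) (h' : (u, v') ∈ M) : v = v' := by
  by_contra hne
  exact (hM _ h _ h' (by simp [hne])).1 rfl

lemma IsMatching.left_unique {M : Finset (Fin n × Fin n)} (hM : IsMatching M) {u u' v : Fin n}
    (h : (u, v) ∈ M) (h' : (u', v) ∈ M) : u = u' := by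
  by_contra hne
  exact (hM _ h _ h' (by simp [hne])).2 rfl

lemma IsMatching.card_endpoints {M : Finset (Fin n × Fin n)} (hM : IsMatching M) :
    #(endpoints M) = 2 * #M := by
  rw [endpoints, card_union_of_disjoint, card_image_of_injOn, card_image_of_injOn, two_mul]
  · rintro ⟨u, v⟩ h ⟨u', v'⟩ h' heq
    obtain rfl : v = v' := Sum.inr.inj heq
    rw [hM.left_unique h h']
  · rintro ⟨u, v⟩ h ⟨u', v'⟩ h' heq
    obtain rfl : u = u' := Sum.inl.inj heq
    rw [hM.right_unique h h']
  · rw [disjoint_left]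
    simp

/-- The colouring of the non-central endpoints of `M` in which every vertex gets the colour of its
partner if the latter is a centre (the centres of colour `true` being `K`), and `false` if not. -/
def partnerColour (K : Finset (Fin n ⊕ Fin n)) (M : Finset (Fin n × Fin n)) :
    Fin n ⊕ Fin n → Bool
  | Sum.inl u => decide (∃ v, (u, v) ∈ M ∧ Sum.inr v ∈ K)
  | Sum.inr v => decide (∃ u, (u, v) ∈ M ∧ Sum.inl u ∈ K)

lemma monoGraph_of_partnerColour {S M : Finset (Fin n × Fin n)} (hM : IsMatching M) (hS : S ⊆ M)
    (C : Finset (Fin n ⊕ Fin n)) (hC : ∀ e ∈ M, ¬ (Sum.inl e.1 ∈ C ∧ Sum.inr e.2 ∈ C))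
    (χ : Fin n ⊕ Fin n → Bool)
    (hχ : ∀ v ∈ endpoints M \ (endpoints S ∪ C),
      χ v = partnerColour {v ∈ C | χ v = true} M v)
    {e : Fin n × Fin n} (he : e ∈ M) (heS : e ∉ S) : monoGraph χ e = true := by
  obtain ⟨u, v⟩ := e
  have hl : Sum.inl u ∈ endpoints M \ endpoints S := by
    refine mem_sdiff.2 ⟨inl_mem_endpoints.2 ⟨v, he⟩, fun h => ?_⟩
    obtain ⟨v', h'⟩ := inl_mem_endpoints.1 h
    obtain rfl := hM.right_unique he (hS h')
    exact heS h'
  have hr : Sum.inr v ∈ endpoints M \ endpoints S := by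
    refine mem_sdiff.2 ⟨inr_mem_endpoints.2 ⟨u, he⟩, fun h => ?_⟩
    obtain ⟨u', h'⟩ := inr_mem_endpoints.1 h
    obtain rfl := hM.left_unique he (hS h')
    exact heS h'
  rw [mem_sdiff] at hl hr
  have left : Sum.inl u ∉ C → χ (Sum.inl u) = decide (Sum.inr v ∈ C ∧ χ (Sum.inr v) = true) := by
    intro hu
    rw [hχ _ (by simp [hl, hu])]
    simp only [partnerColour, mem_filter, decide_eq_decide]
    exact ⟨fun ⟨v', h', hv'⟩ => hM.right_unique h' he ▸ hv', fun h => ⟨v, he, h⟩⟩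
  have right : Sum.inr v ∉ C → χ (Sum.inr v) = decide (Sum.inl u ∈ C ∧ χ (Sum.inl u) = true) := by
    intro hv
    rw [hχ _ (by simp [hr, hv])]
    simp only [partnerColour, mem_filter, decide_eq_decide]
    exact ⟨fun ⟨u', h', hu'⟩ => hM.left_unique h' he ▸ hu', fun h => ⟨u, he, h⟩⟩
  have hnot := hC _ he
  simp only [monoGraph, beq_iff_eq]
  by_cases hu : Sum.inl u ∈ C <;> by_cases hv : Sum.inr v ∈ C
  · exact absurd ⟨hu, hv⟩ hnot
  · rw [right hv]; simp [hu]
  · rw [left hu]; simp [hv]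
  · rw [right hv, left hu]; simp [hu, hv]

/-- The members of `F` containing all edges of `S` and covering all vertices of `C`. -/
def link (F : Finset (Finset (Fin n × Fin n))) (S : Finset (Fin n × Fin n))
    (C : Finset (Fin n ⊕ Fin n)) : Finset (Finset (Fin n × Fin n)) :=
  {M ∈ F | S ⊆ M ∧ C ⊆ endpoints M}

lemma mem_link {F : Finset (Finset (Fin n × Fin n))} {S : Finset (Fin n × Fin n)}
    {C : Finset (Fin n ⊕ Fin n)} {M : Finset (Fin n × Fin n)} :
    M ∈ link F S C ↔ M ∈ F ∧ S ⊆ M ∧ C ⊆ endpoints M := by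
  simp [link]

/-- A large family of matchings has a heavy pair of an edge set `S` and a set `C` of further
vertices, such that its link at `(S, C)` is spread. -/
lemma exists_spread_link (r ρ ℓ : ℕ) (hρ : 0 < ρ) (hr : 0 < r)
    (F : Finset (Finset (Fin n × Fin n))) (hF : ∀ M ∈ F, IsMatching M ∧ #M = ℓ)
    (hcard : r ^ ℓ < #F) :
    ∃ (S : Finset (Fin n × Fin n)) (C : Finset (Fin n ⊕ Fin n)),
      Disjoint C (endpoints S) ∧ (link F S C).Nonempty ∧ #S < ℓ ∧
      (∀ A, Disjoint A (endpoints S ∪ C) → #(link F S (C ∪ A)) * ρ ^ #A ≤ #(link F S C)) ∧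
      (∀ e : Fin n × Fin n, Sum.inl e.1 ∈ C → Sum.inr e.2 ∈ C →
        #{M ∈ link F S C | e ∈ M} * r ≤ #(link F S C) * ρ ^ 2) := by
  let P : Finset (Finset (Fin n × Fin n) × Finset (Fin n ⊕ Fin n)) :=
    {p | Disjoint p.2 (endpoints p.1)}
  let φ : Finset (Fin n × Fin n) × Finset (Fin n ⊕ Fin n) → ℕ :=
    fun p => #(link F p.1 p.2) * (r ^ #p.1 * ρ ^ #p.2)
  obtain ⟨⟨S, C⟩, hp, hmax⟩ := exists_max_image P φ ⟨(∅, ∅), by simp [P]⟩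
  have hdisj : Disjoint C (endpoints S) := by simpa [P] using hp
  replace hmax : ∀ S' C', Disjoint C' (endpoints S') → φ (S', C') ≤ φ (S, C) :=
    fun S' C' h => hmax (S', C') (by simpa [P] using h)
  have hbig : r ^ ℓ < φ (S, C) := by
    refine lt_of_lt_of_le ?_ (hmax ∅ ∅ (by simp))
    simpa [φ, link] using hcard
  have hne : (link F S C).Nonempty := by
    rw [← card_pos]
    by_contra h0
    have : #(link F S C) = 0 := by omega
    simp [φ, this] at hbig
  refine ⟨S, C, hdisj, hne, ?_, ?_, ?_⟩
  · obtain ⟨M, hM⟩ := hne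
    obtain ⟨hMF, hSM, hCM⟩ := mem_link.1 hM
    refine lt_of_le_of_ne ((card_le_card hSM).trans (hF M hMF).2.le) fun heq => ?_
    have hSM' : S = M := eq_of_subset_of_card_le hSM (by rw [heq, (hF M hMF).2])
    have hC : C = ∅ := by
      rw [← hSM'] at hCM
      exact disjoint_self_iff_empty C |>.1 (hdisj.mono_right hCM)
    have hone : #(link F S C) ≤ 1 := by
      rw [card_le_one]
      have : ∀ M' ∈ link F S C, S = M' := fun M' hM' => by
        obtain ⟨h1, h2, _⟩ := mem_link.1 hM'
        exact eq_of_subset_of_card_le h2 (by rw [heq, (hF M' h1).2])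
      exact fun a ha b hb => (this a ha).symm.trans (this b hb)
    have : φ (S, C) ≤ r ^ ℓ := by
      simp only [φ, hC, card_empty, pow_zero, mul_one, heq]
      rw [hC] at hone
      exact mul_le_of_le_one_left (Nat.zero_le _) hone
    omega
  · intro A hA
    rw [disjoint_union_right] at hA
    have h := hmax S (C ∪ A) (disjoint_union_left.2 ⟨hdisj, hA.1⟩)
    simp only [φ] at h
    rw [card_union_of_disjoint hA.2.symm, pow_add] at h
    refine Nat.le_of_mul_le_mul_right (c := r ^ #S * ρ ^ #C) ?_ (by positivity)
    linarith
  · intro e hu hv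
    have heS : e ∉ S := fun h =>
      disjoint_left.1 hdisj hu (inl_mem_endpoints.2 ⟨e.2, h⟩)
    have hsub : ({Sum.inl e.1, Sum.inr e.2} : Finset (Fin n ⊕ Fin n)) ⊆ C := by
      simp [insert_subset_iff, hu, hv]
    have h := hmax (insert e S) (C \ {Sum.inl e.1, Sum.inr e.2}) (by
      rw [endpoints_insert, disjoint_union_right]
      exact ⟨sdiff_disjoint, hdisj.mono_left sdiff_subset⟩)
    simp only [φ] at h
    rw [card_insert_of_notMem heS] at h
    have hCc : #(C \ {Sum.inl e.1, Sum.inr e.2}) + 2 = #C := by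
      rw [← card_sdiff_add_card_eq_card hsub]
      simp
    have hle : #{M ∈ link F S C | e ∈ M} ≤
        #(link F (insert e S) (C \ {Sum.inl e.1, Sum.inr e.2})) := by
      refine card_le_card fun M hM => ?_
      simp only [mem_filter, mem_link] at hM ⊢
      exact ⟨hM.1.1, insert_subset hM.2 hM.1.2.1, sdiff_subset.trans hM.1.2.2⟩
    refine Nat.le_of_mul_le_mul_right
      (c := r ^ #S * ρ ^ #(C \ {Sum.inl e.1, Sum.inr e.2})) ?_ (by positivity)
    calc _ = #{M ∈ link F S C | e ∈ M} *
          (r ^ (#S + 1) * ρ ^ #(C \ {Sum.inl e.1, Sum.inr e.2})) := by ring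
      _ ≤ _ := Nat.mul_le_mul_right _ hle
      _ ≤ _ := h
      _ = _ := by rw [← hCc]; ring

/-- Robust sunflower lemma for matchings: in a large family of matchings of size `ℓ` there is a
proper subset `S` of a member such that for almost all two-colourings some member of the family
has all its edges outside `S` monochromatic. -/
lemma exists_matching_sunflower (w T ℓ : ℕ) (hw : 0 < w) (hT : 0 < T) (hℓ : ℓ ≤ w)
    (F : Finset (Finset (Fin n × Fin n))) (hF : ∀ M ∈ F, IsMatching M ∧ #M = ℓ)
    (hcard : (8 * w ^ 2 * (16 * w * T) ^ 2) ^ ℓ < #F) :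
    ∃ S : Finset (Fin n × Fin n), (∃ M ∈ F, S ⊂ M) ∧
      2 ^ T * rejectCount F S ≤ 2 ^ (2 * w) * 2 ^ (2 * n) := by
  set ρ := 16 * w * T with hρdef
  have hρ : 0 < ρ := by positivity
  obtain ⟨S, C, hdisj, hne, hSℓ, hvert, hedge⟩ :=
    exists_spread_link (8 * w ^ 2 * ρ ^ 2) ρ ℓ hρ (by positivity) F hF hcard
  set G := link F S C with hG
  have hGF : ∀ M ∈ G, IsMatching M ∧ #M = ℓ := fun M hM => hF M (mem_link.1 hM).1
  have hCcard : #C ≤ 2 * w := by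
    obtain ⟨M, hM⟩ := hne
    have h := card_le_card (mem_link.1 hM).2.2
    rw [(hGF M hM).1.card_endpoints, (hGF M hM).2] at h
    omega
  let EC : Finset (Fin n × Fin n) := {e | Sum.inl e.1 ∈ C ∧ Sum.inr e.2 ∈ C}
  have hEC : #EC ≤ 4 * w ^ 2 := by
    calc #EC ≤ #(C ×ˢ C) := by
          refine card_le_card_of_injOn (fun e => (Sum.inl e.1, Sum.inr e.2)) ?_ ?_
          · intro e he
            simpa [EC] using he
          · rintro ⟨u, v⟩ _ ⟨u', v'⟩ _ h
            simpa using h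
      _ = #C * #C := card_product _ _
      _ ≤ (2 * w) * (2 * w) := Nat.mul_le_mul hCcard hCcard
      _ = 4 * w ^ 2 := by ring
  let J : Finset (Finset (Fin n × Fin n)) :=
    {M ∈ G | ∀ e ∈ M, ¬ (Sum.inl e.1 ∈ C ∧ Sum.inr e.2 ∈ C)}
  have hGJ : #G ≤ 2 * #J := by
    have hcover : #G ≤ #J + ∑ e ∈ EC, #{M ∈ G | e ∈ M} := by
      calc #G ≤ #(J ∪ EC.biUnion fun e => {M ∈ G | e ∈ M}) := by
            refine card_le_card fun M hM => ?_
            by_cases hMJ : M ∈ J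
            · exact mem_union_left _ hMJ
            · refine mem_union_right _ ?_
              simp only [J, mem_filter, hM, true_and, not_forall, not_not] at hMJ
              obtain ⟨e, he, hb⟩ := hMJ
              exact mem_biUnion.2 ⟨e, by simpa [EC] using hb, by simp [hM, he]⟩
        _ ≤ _ := (card_union_le _ _).trans (Nat.add_le_add_left card_biUnion_le _)
    have hsum : 8 * w ^ 2 * ∑ e ∈ EC, #{M ∈ G | e ∈ M} ≤ 4 * w ^ 2 * #G := by
      rw [mul_sum]
      calc _ ≤ ∑ e ∈ EC, #G := by
            refine sum_le_sum fun e he => ?_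
            simp only [EC, mem_filter, mem_univ, true_and] at he
            refine Nat.le_of_mul_le_mul_right (c := ρ ^ 2) ?_ (by positivity)
            calc _ = #{M ∈ G | e ∈ M} * (8 * w ^ 2 * ρ ^ 2) := by ring
              _ ≤ _ := hedge e he.1 he.2
        _ = #EC * #G := by simp
        _ ≤ _ := Nat.mul_le_mul_right _ hEC
    have : 2 * ∑ e ∈ EC, #{M ∈ G | e ∈ M} ≤ #G := by
      refine Nat.le_of_mul_le_mul_left (c := 4 * w ^ 2) ?_ (by positivity)
      linarith
    omega
  have hJne : J.Nonempty := by
    rw [← card_pos]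
    have := hne.card_pos
    omega
  have hJG : ∀ M ∈ J, M ∈ G := fun M hM => (mem_filter.1 hM).1
  let D : Finset (Fin n × Fin n) → Finset (Fin n ⊕ Fin n) :=
    fun M => endpoints M \ (endpoints S ∪ C)
  have hScard : #(endpoints S) = 2 * #S := by
    obtain ⟨M, hM⟩ := hne
    exact ((hGF M hM).1.mono (mem_link.1 hM).2.1).card_endpoints
  have hD : ∀ M ∈ J, #(D M) = 2 * ℓ - (2 * #S + #C) := by
    intro M hM
    have hMG := mem_link.1 (hJG M hM)
    rw [card_sdiff_of_subset (union_subset (endpoints_mono hMG.2.1) hMG.2.2),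
      card_union_of_disjoint hdisj.symm, hScard, (hGF M (hJG M hM)).1.card_endpoints,
      (hGF M (hJG M hM)).2]
  have hspread : ∀ A, #{M ∈ J | A ⊆ D M} * ρ ^ #A ≤ 2 * #J := by
    intro A
    by_cases hA : Disjoint A (endpoints S ∪ C)
    · refine le_trans (Nat.mul_le_mul_right _ (card_le_card fun M hM => ?_))
        ((hvert A hA).trans hGJ)
      simp only [mem_filter] at hM
      have hMG := mem_link.1 (hJG M hM.1)
      exact mem_link.2 ⟨hMG.1, hMG.2.1, union_subset hMG.2.2 (hM.2.trans sdiff_subset)⟩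
    · have : ({M ∈ J | A ⊆ D M} : Finset _) = ∅ :=
        filter_eq_empty_iff.2 fun M _ h => hA (disjoint_of_subset_left h sdiff_disjoint)
      simp [this]
  have hbad : ∀ K : Finset (Fin n ⊕ Fin n),
      2 ^ T * #{χ : Fin n ⊕ Fin n → Bool |
        ∀ M ∈ J, ¬ ∀ v ∈ D M, χ v = partnerColour K M v} ≤ 2 ^ (2 * n) := by
    intro K
    have h := two_pow_mul_card_avoid_le J D (partnerColour K) _ ρ T hJne hD hT (by
      rw [hρdef]
      calc _ ≤ 4 * (2 * w) * (2 * T) := by gcongr; omega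
        _ = _ := by ring) hρ hspread
    have hV : Fintype.card (Fin n ⊕ Fin n) = 2 * n := by simp [two_mul]
    rw [hV] at h
    convert h
  refine ⟨S, ?_, ?_⟩
  · obtain ⟨M, hM⟩ := hne
    refine ⟨M, (mem_link.1 hM).1, (mem_link.1 hM).2.1.ssubset_of_ne ?_⟩
    rintro rfl
    exact hSℓ.ne (hGF S hM).2
  · have hcov : rejectCount F S ≤ ∑ K ∈ C.powerset, #{χ : Fin n ⊕ Fin n → Bool |
        ∀ M ∈ J, ¬ ∀ v ∈ D M, χ v = partnerColour K M v} := by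
      refine le_trans (card_le_card fun χ hχ => ?_) card_biUnion_le
      simp only [mem_filter, mem_univ, true_and] at hχ
      refine mem_biUnion.2 ⟨({v ∈ C | χ v = true} : Finset _),
        mem_powerset.2 (filter_subset _ _), ?_⟩
      simp only [mem_filter, mem_univ, true_and]
      intro M hM hall
      have hMG := mem_link.1 (hJG M hM)
      refine hχ ⟨M, hMG.1, fun e he => ?_⟩
      by_cases heS : e ∈ S
      · simp [heS]
      · simp [monoGraph_of_partnerColour (hF M hMG.1).1 hMG.2.1 C (mem_filter.1 hM).2 χ hall he heS]
    calc 2 ^ T * rejectCount F S ≤ _ := Nat.mul_le_mul_left _ hcov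
      _ ≤ ∑ K ∈ C.powerset, 2 ^ (2 * n) := by
          rw [mul_sum]
          exact sum_le_sum fun K _ => hbad K
      _ = 2 ^ #C * 2 ^ (2 * n) := by simp
      _ ≤ _ := by gcongr; norm_num

instance : DecidablePred (IsMatching (n := n)) := fun M =>
  inferInstanceAs (Decidable (∀ e ∈ M, ∀ e' ∈ M, e ≠ e' → e.1 ≠ e'.1 ∧ e.2 ≠ e'.2))

/-- The matchings of `K_{n,n}` with at most `w` edges. -/
def smallMatchings (n w : ℕ) : Finset (Finset (Fin n × Fin n)) :=
  {M | IsMatching M ∧ #M ≤ w}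

lemma mem_smallMatchings {w : ℕ} {M : Finset (Fin n × Fin n)} :
    M ∈ smallMatchings n w ↔ IsMatching M ∧ #M ≤ w := by
  simp [smallMatchings]

lemma card_smallMatchings_le (w : ℕ) (hn : 0 < n) :
    #(smallMatchings n w) ≤ (w + 1) * (n ^ 2) ^ w := by
  calc #(smallMatchings n w)
      ≤ #((range (w + 1)).biUnion fun k => powersetCard k (univ : Finset (Fin n × Fin n))) := by
        refine card_le_card fun M hM => ?_
        have := (mem_smallMatchings.1 hM).2
        simp only [mem_biUnion, mem_range, mem_powersetCard, subset_univ, true_and]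
        exact ⟨#M, by omega, rfl⟩
    _ ≤ ∑ k ∈ range (w + 1), #(powersetCard k (univ : Finset (Fin n × Fin n))) := card_biUnion_le
    _ ≤ ∑ k ∈ range (w + 1), (n ^ 2) ^ w := by
        refine sum_le_sum fun k hk => ?_
        rw [card_powersetCard, card_univ, Fintype.card_prod, Fintype.card_fin, ← sq]
        exact (Nat.choose_le_pow _ _).trans
          (Nat.pow_le_pow_right (by positivity) (by simpa [Nat.lt_succ_iff] using hk))
    _ = _ := by simp

lemma Accepts.mono_family {F G : Finset (Finset (Fin n × Fin n))} (h : F ⊆ G)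
    {x : Fin n × Fin n → Bool} (hx : Accepts F x) : Accepts G x :=
  let ⟨M, hM, hMx⟩ := hx
  ⟨M, h hM, hMx⟩

lemma rejectCount_anti {F G : Finset (Finset (Fin n × Fin n))} (h : F ⊆ G)
    (S : Finset (Fin n × Fin n)) : rejectCount G S ≤ rejectCount F S := by
  refine card_le_card fun χ hχ => ?_
  simp only [mem_filter, mem_univ, true_and] at hχ ⊢
  exact fun hF => hχ (hF.mono_family h)

/-- A family of small matchings is closed if it contains every small matching `S` with the property
that almost all graphs of monochromatic edges, enlarged by `S`, contain a member of the family. -/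
structure IsClosedFamily (w t : ℕ) (F : Finset (Finset (Fin n × Fin n))) : Prop where
  subset : F ⊆ smallMatchings n w
  closed : ∀ S ∈ smallMatchings n w, 2 ^ t * rejectCount F S ≤ 2 ^ (2 * n) → S ∈ F

namespace IsClosedFamily

variable {w t : ℕ} {F G : Finset (Finset (Fin n × Fin n))}

lemma inter (hF : IsClosedFamily w t F) (hG : IsClosedFamily w t G) :
    IsClosedFamily w t (F ∩ G) where
  subset := inter_subset_left.trans hF.subset
  closed S hS h := mem_inter.2
    ⟨hF.closed S hS ((Nat.mul_le_mul_left _ (rejectCount_anti inter_subset_left S)).trans h),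
      hG.closed S hS ((Nat.mul_le_mul_left _ (rejectCount_anti inter_subset_right S)).trans h)⟩

lemma mem_of_subset (hF : IsClosedFamily w t F) {M S : Finset (Fin n × Fin n)} (hM : M ∈ F)
    (hMS : M ⊆ S) (hS : S ∈ smallMatchings n w) : S ∈ F := by
  refine hF.closed S hS ?_
  have : rejectCount F S = 0 := by
    rw [rejectCount, card_eq_zero, filter_eq_empty_iff]
    intro χ _ h
    exact h ⟨M, hM, fun e he => by simp [hMS he]⟩
  simp [this]

end IsClosedFamily

/-- Every family of small matchings is contained in a closed one accepting few more graphs of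
monochromatic edges. -/
lemma exists_isClosedFamily (w t : ℕ) (F : Finset (Finset (Fin n × Fin n)))
    (hF : F ⊆ smallMatchings n w) :
    ∃ G, F ⊆ G ∧ IsClosedFamily w t G ∧
      2 ^ t * #{χ : Fin n ⊕ Fin n → Bool |
        Accepts G (monoGraph χ) ∧ ¬ Accepts F (monoGraph χ)} ≤
        #(smallMatchings n w \ F) * 2 ^ (2 * n) := by
  induction hk : #(smallMatchings n w \ F) generalizing F with
  | zero =>
    have hsub : smallMatchings n w ⊆ F := by
      rwa [card_eq_zero, sdiff_eq_empty_iff_subset] at hk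
    exact ⟨F, Subset.rfl, ⟨hF, fun S hS _ => hsub hS⟩, by simp⟩
  | succ k ih =>
    by_cases hcl : ∀ S ∈ smallMatchings n w, 2 ^ t * rejectCount F S ≤ 2 ^ (2 * n) → S ∈ F
    · exact ⟨F, Subset.rfl, ⟨hF, hcl⟩, by simp⟩
    push Not at hcl
    obtain ⟨S, hS, hrej, hSF⟩ := hcl
    obtain ⟨G, hFG, hG, hcount⟩ := ih (insert S F) (insert_subset hS hF) (by
      rw [sdiff_insert, card_erase_of_mem (mem_sdiff.2 ⟨hS, hSF⟩), hk]
      rfl)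
    refine ⟨G, (subset_insert S F).trans hFG, hG, ?_⟩
    have hsplit : #{χ : Fin n ⊕ Fin n → Bool |
        Accepts G (monoGraph χ) ∧ ¬ Accepts F (monoGraph χ)} ≤
        #{χ : Fin n ⊕ Fin n → Bool |
          Accepts G (monoGraph χ) ∧ ¬ Accepts (insert S F) (monoGraph χ)} + rejectCount F S := by
      refine le_trans (card_le_card fun χ hχ => ?_) (card_union_le _ _)
      simp only [mem_filter, mem_univ, true_and, mem_union] at hχ ⊢
      by_cases hins : Accepts (insert S F) (monoGraph χ)
      · right
        rintro ⟨M, hM, hMx⟩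
        obtain ⟨M', hM', hMx'⟩ := hins
        rcases mem_insert.1 hM' with rfl | hM'
        · refine hχ.2 ⟨M, hM, fun e he => ?_⟩
          by_cases heS : e ∈ M'
          · exact hMx' e heS
          · simpa [heS] using hMx e he
        · exact hχ.2 ⟨M', hM', hMx'⟩
      · exact Or.inl ⟨hχ.1, hins⟩
    calc _ ≤ _ := Nat.mul_le_mul_left _ hsplit
      _ = _ := mul_add _ _ _
      _ ≤ k * 2 ^ (2 * n) + 2 ^ (2 * n) := add_le_add hcount hrej
      _ = _ := by ring

/-- The inclusion-minimal members of a family. -/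
def minimalMembers (F : Finset (Finset (Fin n × Fin n))) : Finset (Finset (Fin n × Fin n)) :=
  {M ∈ F | ∀ S ∈ F, ¬ S ⊂ M}

lemma exists_minimalMembers_subset {F : Finset (Finset (Fin n × Fin n))}
    {M : Finset (Fin n × Fin n)} (hM : M ∈ F) : ∃ S ∈ minimalMembers F, S ⊆ M := by
  induction M using Finset.strongInduction with
  | H M ih =>
    by_cases h : ∃ S ∈ F, S ⊂ M
    · obtain ⟨S, hS, hSM⟩ := h
      obtain ⟨S', hS', hsub⟩ := ih S hSM hS
      exact ⟨S', hS', hsub.trans hSM.subset⟩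
    · push Not at h
      exact ⟨M, mem_filter.2 ⟨hM, h⟩, Subset.rfl⟩

lemma IsClosedFamily.card_minimalMembers_le {w t : ℕ} {F : Finset (Finset (Fin n × Fin n))}
    (hF : IsClosedFamily w t F) (hw : 0 < w) {ℓ : ℕ} (hℓ : ℓ ≤ w) :
    #{M ∈ minimalMembers F | #M = ℓ} ≤ (8 * w ^ 2 * (16 * w * (2 * w + t)) ^ 2) ^ ℓ := by
  by_contra! hlt
  have hsub : ({M ∈ minimalMembers F | #M = ℓ} : Finset _) ⊆ F :=
    (filter_subset _ _).trans (filter_subset _ _)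
  obtain ⟨S, ⟨M, hM, hSM⟩, hrej⟩ := exists_matching_sunflower w (2 * w + t) ℓ hw (by omega) hℓ
    {M ∈ minimalMembers F | #M = ℓ}
    (fun M hM => ⟨(mem_smallMatchings.1 (hF.subset (hsub hM))).1, (mem_filter.1 hM).2⟩) hlt
  have hMF := mem_smallMatchings.1 (hF.subset (hsub hM))
  have hS : S ∈ F := by
    refine hF.closed S (mem_smallMatchings.2
      ⟨hMF.1.mono hSM.subset, (card_le_card hSM.subset).trans hMF.2⟩) ?_
    rw [pow_add, mul_assoc] at hrej
    exact (Nat.mul_le_mul_left _ (rejectCount_anti hsub S)).trans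
      (Nat.le_of_mul_le_mul_left hrej (by positivity))
  exact (mem_filter.1 (mem_filter.1 hM).1).2 S hS hSM

/-- The perfect matching of `K_{n,n}` given by a permutation. -/
def permGraph (σ : Equiv.Perm (Fin n)) (e : Fin n × Fin n) : Bool :=
  decide (σ e.1 = e.2)

lemma card_perm_insert_mul_le {M : Finset (Fin n × Fin n)} {e : Fin n × Fin n}
    (he : e ∉ M) (hM : IsMatching (insert e M)) :
    #{σ : Equiv.Perm (Fin n) | ∀ f ∈ insert e M, permGraph σ f = true} * (n - #M) ≤
      #{σ : Equiv.Perm (Fin n) | ∀ f ∈ M, permGraph σ f = true} := by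
  have hcard : n - #M ≤ #(univ \ M.image Prod.snd) := by
    rw [card_sdiff_of_subset (subset_univ _), card_univ, Fintype.card_fin]
    exact Nat.sub_le_sub_left card_image_le n
  refine (Nat.mul_le_mul_left _ hcard).trans ?_
  rw [← card_product]
  refine card_le_card_of_injOn (fun z => Equiv.swap e.2 z.2 * z.1) ?_ ?_
  · rintro ⟨σ, v⟩ hz
    simp only [coe_product, Set.mem_prod, mem_coe, mem_filter, mem_univ, true_and, mem_sdiff,
      mem_image, not_exists, not_and, permGraph, decide_eq_true_eq, forall_mem_insert] at hz ⊢
    intro f hf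
    rw [Equiv.Perm.mul_apply, hz.1.2 f hf]
    refine Equiv.swap_apply_of_ne_of_ne ?_ (hz.2 f hf)
    exact (hM f (mem_insert_of_mem hf) e (mem_insert_self _ _) fun h => he (h ▸ hf)).2
  · rintro ⟨σ, v⟩ hz ⟨σ', v'⟩ hz' h
    simp only [coe_product, Set.mem_prod, mem_coe, mem_filter, mem_univ, true_and, mem_sdiff,
      mem_image, not_exists, not_and, permGraph, decide_eq_true_eq, forall_mem_insert] at hz hz' h
    have hv := congrArg (fun τ : Equiv.Perm (Fin n) => τ e.1) h
    simp only [Equiv.Perm.mul_apply, hz.1.1, hz'.1.1, Equiv.swap_apply_left] at hv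
    subst hv
    rw [mul_left_cancel h]

lemma card_perm_mul_le {w : ℕ} {M : Finset (Fin n × Fin n)} (hM : IsMatching M) (hw : #M ≤ w) :
    #{σ : Equiv.Perm (Fin n) | ∀ f ∈ M, permGraph σ f = true} * (n - w) ^ #M ≤ n.factorial := by
  induction M using Finset.induction_on with
  | empty => simp [Fintype.card_perm]
  | insert e M he ih =>
    have hc := card_insert_of_notMem he
    rw [hc] at hw ⊢
    calc _ = #{σ : Equiv.Perm (Fin n) | ∀ f ∈ insert e M, permGraph σ f = true} * (n - w) *
          (n - w) ^ #M := by ring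
      _ ≤ #{σ : Equiv.Perm (Fin n) | ∀ f ∈ insert e M, permGraph σ f = true} * (n - #M) *
          (n - w) ^ #M := by gcongr; omega
      _ ≤ _ := Nat.mul_le_mul_right _ (card_perm_insert_mul_le he hM)
      _ ≤ _ := ih (hM.mono (subset_insert e M)) (by omega)

/-- Few perfect matchings contain a large minimal member of a closed family. -/
lemma IsClosedFamily.card_perm_minimalMembers_le {w t : ℕ}
    {F : Finset (Finset (Fin n × Fin n))} (hF : IsClosedFamily w t F) (hw : 0 < w)
    (hn : 4 * (8 * w ^ 2 * (16 * w * (2 * w + t)) ^ 2) ≤ n - w) (a : ℕ) :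
    4 ^ a * #{σ : Equiv.Perm (Fin n) |
      ∃ M ∈ minimalMembers F, a ≤ #M ∧ ∀ e ∈ M, permGraph σ e = true} ≤ 2 * n.factorial := by
  set r := 8 * w ^ 2 * (16 * w * (2 * w + t)) ^ 2 with hr
  have hr0 : 0 < r := by positivity
  have hsmall : ∀ M ∈ minimalMembers F, IsMatching M ∧ #M ≤ w := fun M hM =>
    mem_smallMatchings.1 (hF.subset (mem_filter.1 hM).1)
  let B : ℕ → Finset (Equiv.Perm (Fin n)) := fun ℓ =>
    ({M ∈ minimalMembers F | #M = ℓ} : Finset _).biUnion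
      fun M => {σ : Equiv.Perm (Fin n) | ∀ e ∈ M, permGraph σ e = true}
  have hB : ∀ ℓ ≤ w, 4 ^ ℓ * #(B ℓ) ≤ n.factorial := by
    intro ℓ hℓ
    refine Nat.le_of_mul_le_mul_left (c := r ^ ℓ) ?_ (by positivity)
    calc r ^ ℓ * (4 ^ ℓ * #(B ℓ)) = #(B ℓ) * (4 * r) ^ ℓ := by rw [mul_pow 4 r]; ring
      _ ≤ #(B ℓ) * (n - w) ^ ℓ := by gcongr
      _ ≤ (∑ M ∈ minimalMembers F with #M = ℓ,
          #{σ : Equiv.Perm (Fin n) | ∀ e ∈ M, permGraph σ e = true}) * (n - w) ^ ℓ :=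
        Nat.mul_le_mul_right _ card_biUnion_le
      _ ≤ ∑ M ∈ minimalMembers F with #M = ℓ, n.factorial := by
        rw [sum_mul]
        refine sum_le_sum fun M hM => ?_
        obtain ⟨hMmin, hMℓ⟩ := mem_filter.1 hM
        rw [← hMℓ]
        exact card_perm_mul_le (hsmall M hMmin).1 (hsmall M hMmin).2
      _ = #{M ∈ minimalMembers F | #M = ℓ} * n.factorial := by simp
      _ ≤ r ^ ℓ * n.factorial :=
        Nat.mul_le_mul_right _ (hF.card_minimalMembers_le hw hℓ)
  have hcover : #{σ : Equiv.Perm (Fin n) |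
      ∃ M ∈ minimalMembers F, a ≤ #M ∧ ∀ e ∈ M, permGraph σ e = true} ≤
      ∑ ℓ ∈ Ico a (w + 1), #(B ℓ) := by
    refine le_trans (card_le_card fun σ hσ => ?_) card_biUnion_le
    obtain ⟨M, hM, haM, hMσ⟩ := (mem_filter.1 hσ).2
    have := (hsmall M hM).2
    refine mem_biUnion.2 ⟨#M, by rw [mem_Ico]; omega, mem_biUnion.2 ⟨M, ?_, ?_⟩⟩
    · simp [hM]
    · simpa using hMσ
  have hreal : (#{σ : Equiv.Perm (Fin n) |
      ∃ M ∈ minimalMembers F, a ≤ #M ∧ ∀ e ∈ M, permGraph σ e = true} : ℝ) ≤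
      2 * n.factorial * (1 / 4) ^ a := by
    calc _ ≤ ∑ ℓ ∈ Ico a (w + 1), (#(B ℓ) : ℝ) := by exact_mod_cast hcover
      _ ≤ ∑ ℓ ∈ Ico a (w + 1), (n.factorial : ℝ) * (1 / 4) ^ ℓ := by
        refine sum_le_sum fun ℓ hℓ => ?_
        rw [mem_Ico] at hℓ
        have h : (4 : ℝ) ^ ℓ * #(B ℓ) ≤ n.factorial := by exact_mod_cast hB ℓ (by omega)
        rw [one_div_pow, mul_one_div, le_div_iff₀ (by positivity)]
        linarith
      _ = (n.factorial : ℝ) * ∑ ℓ ∈ Ico a (w + 1), (1 / 4 : ℝ) ^ ℓ := (mul_sum _ _ _).symm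
      _ ≤ (n.factorial : ℝ) * ((1 / 4) ^ a / (1 - 1 / 4)) := by
        gcongr
        exact geom_sum_Ico_le_of_lt_one (by norm_num) (by norm_num)
      _ = 4 / 3 * (n.factorial * (1 / 4) ^ a) := by ring
      _ ≤ _ := by
        have : (0 : ℝ) ≤ n.factorial * (1 / 4) ^ a := by positivity
        linarith
  rw [one_div_pow, mul_one_div, le_div_iff₀ (by positivity)] at hreal
  rw [mul_comm]
  exact_mod_cast hreal

lemma MonCircuit.eval_of_gate_inl {ι : Type} (C : MonCircuit ι) (x : ι → Bool) {i : Fin C.size}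
    {j : ι} (h : C.gate i = Sum.inl j) : C.eval x i = x j := by
  rw [MonCircuit.eval, h]

lemma MonCircuit.eval_of_gate_and {ι : Type} (C : MonCircuit ι) (x : ι → Bool) {i : Fin C.size}
    {j k : Fin i.val} (h : C.gate i = Sum.inr (true, j, k)) :
    C.eval x i = (C.eval x ⟨j, j.isLt.trans i.isLt⟩ && C.eval x ⟨k, k.isLt.trans i.isLt⟩) := by
  rw [MonCircuit.eval, h]
  rfl

lemma MonCircuit.eval_of_gate_or {ι : Type} (C : MonCircuit ι) (x : ι → Bool) {i : Fin C.size}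
    {j k : Fin i.val} (h : C.gate i = Sum.inr (false, j, k)) :
    C.eval x i = (C.eval x ⟨j, j.isLt.trans i.isLt⟩ || C.eval x ⟨k, k.isLt.trans i.isLt⟩) := by
  rw [MonCircuit.eval, h]
  rfl

lemma isMatching_of_permGraph {σ : Equiv.Perm (Fin n)} {M : Finset (Fin n × Fin n)}
    (h : ∀ e ∈ M, permGraph σ e = true) : IsMatching M := by
  rintro ⟨u, v⟩ he ⟨u', v'⟩ he' hne
  have h₁ : σ u = v := by simpa [permGraph] using h _ he
  have h₂ : σ u' = v' := by simpa [permGraph] using h _ he'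
  subst h₁ h₂
  have huu' : u ≠ u' := fun huu' => hne (by rw [huu'])
  exact ⟨huu', fun hσ => huu' (σ.injective hσ)⟩

/-- The family `F` approximates the boolean function `f` from below on the graphs of monochromatic
edges outside `N`, and from above on the perfect matchings outside `P`. -/
structure Approximates (F : Finset (Finset (Fin n × Fin n))) (f : (Fin n × Fin n → Bool) → Bool)
    (N : Finset (Fin n ⊕ Fin n → Bool)) (P : Finset (Equiv.Perm (Fin n))) : Prop where
  of_accepts : ∀ χ ∉ N, Accepts F (monoGraph χ) → f (monoGraph χ) = true
  accepts : ∀ σ ∉ P, f (permGraph σ) = true → Accepts F (permGraph σ)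

lemma Approximates.mono {F : Finset (Finset (Fin n × Fin n))} {f : (Fin n × Fin n → Bool) → Bool}
    {N N' : Finset (Fin n ⊕ Fin n → Bool)} {P P' : Finset (Equiv.Perm (Fin n))}
    (h : Approximates F f N P) (hN : N ⊆ N') (hP : P ⊆ P') : Approximates F f N' P' :=
  ⟨fun χ hχ => h.of_accepts χ fun hχN => hχ (hN hχN), fun σ hσ => h.accepts σ fun hσP => hσ (hP hσP)⟩

lemma exists_approximates_input {w : ℕ} (t : ℕ) (hw : 0 < w) (e : Fin n × Fin n) :
    ∃ F N, IsClosedFamily w t F ∧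
      2 ^ t * #N ≤ #(smallMatchings n w) * 2 ^ (2 * n) ∧ Approximates F (fun x => x e) N ∅ := by
  obtain ⟨F, heF, hF, hcard⟩ := exists_isClosedFamily w t {{e}} (by
    rw [singleton_subset_iff, mem_smallMatchings]
    refine ⟨fun a ha b hb hab => (hab ?_).elim, by rwa [card_singleton]⟩
    rw [mem_singleton.1 ha, mem_singleton.1 hb])
  refine ⟨F, _, hF, hcard.trans (Nat.mul_le_mul_right _ (card_le_card sdiff_subset)), ?_, ?_⟩
  · intro χ hχ hacc
    have : Accepts {{e}} (monoGraph χ) := by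
      by_contra hn
      exact hχ (by simp [hacc, hn])
    obtain ⟨M, hM, hMχ⟩ := this
    exact hMχ e (by rw [mem_singleton.1 hM]; exact mem_singleton_self e)
  · intro σ _ hσ
    exact ⟨{e}, heF (mem_singleton_self _), by simpa using hσ⟩

lemma exists_approximates_or {w t : ℕ} {F G : Finset (Finset (Fin n × Fin n))}
    {f g : (Fin n × Fin n → Bool) → Bool} {N : Finset (Fin n ⊕ Fin n → Bool)}
    {P : Finset (Equiv.Perm (Fin n))} (hF : IsClosedFamily w t F) (hG : IsClosedFamily w t G)
    (hf : Approximates F f N P) (hg : Approximates G g N P) :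
    ∃ H N', IsClosedFamily w t H ∧ 2 ^ t * #N' ≤ #(smallMatchings n w) * 2 ^ (2 * n) ∧
      Approximates H (fun x => f x || g x) (N ∪ N') P := by
  obtain ⟨H, hFGH, hH, hcard⟩ := exists_isClosedFamily w t (F ∪ G)
    (union_subset hF.subset hG.subset)
  refine ⟨H, _, hH, hcard.trans (Nat.mul_le_mul_right _ (card_le_card sdiff_subset)), ?_, ?_⟩
  · intro χ hχ hacc
    rw [mem_union, not_or] at hχ
    have : Accepts (F ∪ G) (monoGraph χ) := by
      by_contra hn
      exact hχ.2 (by simp [hacc, hn])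
    obtain ⟨M, hM, hMχ⟩ := this
    rcases mem_union.1 hM with hM | hM
    · simp [hf.of_accepts χ hχ.1 ⟨M, hM, hMχ⟩]
    · simp [hg.of_accepts χ hχ.1 ⟨M, hM, hMχ⟩]
  · intro σ hσ hfg
    rcases Bool.or_eq_true_iff.1 hfg with h | h
    · exact (hf.accepts σ hσ h).mono_family (subset_union_left.trans hFGH)
    · exact (hg.accepts σ hσ h).mono_family (subset_union_right.trans hFGH)

lemma exists_approximates_and {a t : ℕ} (ha : 0 < a)
    (hn : 4 * (8 * (2 * a) ^ 2 * (16 * (2 * a) * (2 * (2 * a) + t)) ^ 2) ≤ n - 2 * a)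
    {F G : Finset (Finset (Fin n × Fin n))}
    {f g : (Fin n × Fin n → Bool) → Bool} {N : Finset (Fin n ⊕ Fin n → Bool)}
    {P : Finset (Equiv.Perm (Fin n))} (hF : IsClosedFamily (2 * a) t F)
    (hG : IsClosedFamily (2 * a) t G) (hf : Approximates F f N P) (hg : Approximates G g N P) :
    ∃ H P', IsClosedFamily (2 * a) t H ∧ 4 ^ a * #P' ≤ 4 * n.factorial ∧
      Approximates H (fun x => f x && g x) N (P ∪ P') := by
  have hPF := hF.card_perm_minimalMembers_le (by omega) hn a
  have hPG := hG.card_perm_minimalMembers_le (by omega) hn a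
  refine ⟨F ∩ G, _ ∪ _, hF.inter hG, (Nat.mul_le_mul_left _ (card_union_le _ _)).trans
    ((mul_add _ _ _).trans_le ((add_le_add hPF hPG).trans (by omega))), ?_, ?_⟩
  · intro χ hχ hacc
    simp [hf.of_accepts χ hχ (hacc.mono_family inter_subset_left),
      hg.of_accepts χ hχ (hacc.mono_family inter_subset_right)]
  · intro σ hσ hfg
    rw [Bool.and_eq_true_iff] at hfg
    simp only [mem_union, not_or, mem_filter, mem_univ, true_and, not_exists, not_and] at hσ
    obtain ⟨hσP, hσF, hσG⟩ := hσ
    obtain ⟨A', hA', hA'σ⟩ := hf.accepts σ hσP hfg.1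
    obtain ⟨B', hB', hB'σ⟩ := hg.accepts σ hσP hfg.2
    obtain ⟨A, hA, hAA'⟩ := exists_minimalMembers_subset hA'
    obtain ⟨B, hB, hBB'⟩ := exists_minimalMembers_subset hB'
    have hAσ : ∀ e ∈ A, permGraph σ e = true := fun e he => hA'σ e (hAA' he)
    have hBσ : ∀ e ∈ B, permGraph σ e = true := fun e he => hB'σ e (hBB' he)
    have hAa : #A < a := by
      by_contra! h
      exact hσF A hA h hAσ
    have hBa : #B < a := by
      by_contra! h
      exact hσG B hB h hBσ
    have hABσ : ∀ e ∈ A ∪ B, permGraph σ e = true := fun e he =>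
      (mem_union.1 he).elim (hAσ e) (hBσ e)
    have hAB : A ∪ B ∈ smallMatchings n (2 * a) :=
      mem_smallMatchings.2 ⟨isMatching_of_permGraph hABσ,
        (card_union_le _ _).trans (by omega)⟩
    exact ⟨A ∪ B, mem_inter.2 ⟨hF.mem_of_subset (mem_filter.1 hA).1 subset_union_left hAB,
      hG.mem_of_subset (mem_filter.1 hB).1 subset_union_right hAB⟩, hABσ⟩

/-- The method of approximations: all gates of a small circuit are simultaneously approximated by
closed families, with few errors. -/
lemma MonCircuit.exists_approximates {a t : ℕ} (ha : 0 < a)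
    (hn : 4 * (8 * (2 * a) ^ 2 * (16 * (2 * a) * (2 * (2 * a) + t)) ^ 2) ≤ n - 2 * a)
    (C : MonCircuit (Fin n × Fin n)) :
    ∀ k ≤ C.size, ∃ N P,
      2 ^ t * #N ≤ k * (#(smallMatchings n (2 * a)) * 2 ^ (2 * n)) ∧
      4 ^ a * #P ≤ k * (4 * n.factorial) ∧
      ∀ i : Fin C.size, i.val < k → ∃ F, IsClosedFamily (2 * a) t F ∧
        Approximates F (fun x => C.eval x i) N P := by
  intro k
  induction k with
  | zero => exact fun _ => ⟨∅, ∅, by simp, by simp, by simp⟩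
  | succ k ih =>
    intro hk
    obtain ⟨N, P, hN, hP, happ⟩ := ih (by omega)
    suffices h : ∃ F N' P', IsClosedFamily (2 * a) t F ∧
        2 ^ t * #N' ≤ #(smallMatchings n (2 * a)) * 2 ^ (2 * n) ∧
        4 ^ a * #P' ≤ 4 * n.factorial ∧
        Approximates F (fun x => C.eval x ⟨k, hk⟩) (N ∪ N') (P ∪ P') by
      obtain ⟨F, N', P', hF, hN', hP', hFapp⟩ := h
      refine ⟨N ∪ N', P ∪ P', ?_, ?_, fun i hi => ?_⟩
      · rw [add_mul, one_mul]
        exact (Nat.mul_le_mul_left _ (card_union_le _ _)).trans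
          ((mul_add _ _ _).trans_le (add_le_add hN hN'))
      · rw [add_mul, one_mul]
        exact (Nat.mul_le_mul_left _ (card_union_le _ _)).trans
          ((mul_add _ _ _).trans_le (add_le_add hP hP'))
      · rcases (Nat.lt_succ_iff_lt_or_eq.1 hi) with hi | hi
        · obtain ⟨G, hG, hGapp⟩ := happ i hi
          exact ⟨G, hG, hGapp.mono subset_union_left subset_union_left⟩
        · obtain rfl : i = ⟨k, hk⟩ := Fin.ext hi
          exact ⟨F, hF, hFapp⟩
    rcases hgate : C.gate ⟨k, hk⟩ with e | ⟨_ | _, i, j⟩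
    · obtain ⟨F, N', hF, hN', hFapp⟩ :=
        exists_approximates_input (w := 2 * a) t (by omega) e
      refine ⟨F, N', ∅, hF, hN', by simp, ?_⟩
      simp only [C.eval_of_gate_inl _ hgate]
      exact hFapp.mono subset_union_right (empty_subset _)
    · obtain ⟨F, hF, hFapp⟩ := happ ⟨i, i.isLt.trans hk⟩ i.isLt
      obtain ⟨G, hG, hGapp⟩ := happ ⟨j, j.isLt.trans hk⟩ j.isLt
      obtain ⟨H, N', hH, hN', hHapp⟩ := exists_approximates_or hF hG hFapp hGapp
      refine ⟨H, N', ∅, hH, hN', by simp, ?_⟩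
      simp only [C.eval_of_gate_or _ hgate]
      exact hHapp.mono subset_rfl subset_union_left
    · obtain ⟨F, hF, hFapp⟩ := happ ⟨i, i.isLt.trans hk⟩ i.isLt
      obtain ⟨G, hG, hGapp⟩ := happ ⟨j, j.isLt.trans hk⟩ j.isLt
      obtain ⟨H, P', hH, hP', hHapp⟩ := exists_approximates_and ha hn hF hG hFapp hGapp
      refine ⟨H, ∅, P', hH, by simp, hP', ?_⟩
      simp only [C.eval_of_gate_and _ hgate]
      exact hHapp.mono subset_union_left subset_rfl

lemma oddFactorProp_permGraph (σ : Equiv.Perm (Fin n)) : OddFactorProp n (permGraph σ) := by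
  refine ⟨univ.filter fun e => σ e.1 = e.2, by simp [permGraph], fun u => ?_, fun v => ?_⟩
  · convert odd_one
    rw [card_eq_one]
    refine ⟨(u, σ u), ?_⟩
    ext ⟨u', v'⟩
    simp only [mem_filter, mem_univ, true_and, mem_singleton, Prod.mk.injEq]
    grind
  · convert odd_one
    rw [card_eq_one]
    refine ⟨(σ.symm v, v), ?_⟩
    ext ⟨u', v'⟩
    simp only [mem_filter, mem_univ, true_and, mem_singleton, Prod.mk.injEq, Equiv.eq_symm_apply]
    grind

/-- Vertices of odd degree come in pairs within each colour class of a graph all of whose edges are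
monochromatic. -/
lemma not_oddFactorProp_monoGraph {χ : Fin n ⊕ Fin n → Bool} (hχ : Odd #{v | χ v = true}) :
    ¬ OddFactorProp n (monoGraph χ) := by
  rintro ⟨y, hy, hL, hR⟩
  have key : ∀ (π : Fin n × Fin n → Fin n) (A : Finset (Fin n)),
      (∀ v, Odd #{e ∈ y | π e = v}) → ((#{e ∈ y | π e ∈ A} : ℕ) : ZMod 2) = #A := by
    intro π A hπ
    have hmaps : Set.MapsTo π ({e ∈ y | π e ∈ A} : Finset _) A := fun e he => (mem_filter.1 he).2
    rw [card_eq_sum_card_fiberwise hmaps, Nat.cast_sum, card_eq_sum_ones, Nat.cast_sum]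
    refine sum_congr rfl fun v hv => ?_
    have : ({e ∈ {e ∈ y | π e ∈ A} | π e = v} : Finset _) = {e ∈ y | π e = v} := by
      ext e
      simp only [mem_filter]
      grind
    rw [this, ZMod.natCast_eq_one_iff_odd.2 (hπ v), Nat.cast_one]
  have hl := key Prod.fst {u | χ (Sum.inl u) = true} hL
  have hr := key Prod.snd {v | χ (Sum.inr v) = true} hR
  have heq : ({e ∈ y | e.1 ∈ ({u | χ (Sum.inl u) = true} : Finset _)} : Finset _) =
      {e ∈ y | e.2 ∈ ({v | χ (Sum.inr v) = true} : Finset _)} := by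
    refine filter_congr fun e he => ?_
    have : χ (Sum.inl e.1) = χ (Sum.inr e.2) := by simpa [monoGraph] using hy e he
    simp [this]
  have hcard : #{v | χ v = true} =
      #{u : Fin n | χ (Sum.inl u) = true} + #{v : Fin n | χ (Sum.inr v) = true} := by
    simp only [card_filter, Fintype.sum_sum_type]
  rw [heq, hr] at hl
  have := ZMod.natCast_eq_one_iff_odd.2 hχ
  rw [hcard, Nat.cast_add, hl, CharTwo.add_self_eq_zero] at this
  exact zero_ne_one this

lemma two_pow_le_two_mul_card_odd {V : Type*} [Fintype V] [DecidableEq V] (v₀ : V) :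
    2 ^ Fintype.card V ≤ 2 * #{χ : V → Bool | Odd #{v | χ v = true}} := by
  have hle : #{χ : V → Bool | ¬ Odd #{v | χ v = true}} ≤
      #{χ : V → Bool | Odd #{v | χ v = true}} := by
    refine card_le_card_of_injOn (fun χ => Function.update χ v₀ (!χ v₀)) ?_ ?_
    · intro χ hχ
      simp only [coe_filter, mem_univ, true_and, Set.mem_ofPred_eq, Nat.not_odd_iff_even] at hχ ⊢
      cases h : χ v₀
      · have : (univ.filter fun v => Function.update χ v₀ (!false) v = true) =
            insert v₀ (univ.filter fun v => χ v = true) := by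
          ext v
          by_cases hv : v = v₀ <;> simp [hv]
        rw [this, card_insert_of_notMem (by simp [h])]
        exact hχ.add_one
      · have : (univ.filter fun v => χ v = true) =
            insert v₀ (univ.filter fun v => Function.update χ v₀ (!true) v = true) := by
          ext v
          by_cases hv : v = v₀ <;> simp [hv, h]
        rw [this, card_insert_of_notMem (by simp)] at hχ
        grind
    · intro χ _ ψ _ h
      ext v
      have := congrFun h v
      by_cases hv : v = v₀
      · subst hv
        simpa using this
      · simpa [hv] using this
  have := card_filter_add_card_filter_not (s := (univ : Finset (V → Bool)))
    (fun χ => Odd #{v | χ v = true})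
  simp only [card_univ, Fintype.card_fun, Fintype.card_bool] at this
  omega

lemma MonCircuit.Computes.size_bound {a t : ℕ} (ha : 0 < a) (hn₀ : 0 < n)
    (hn : 4 * (8 * (2 * a) ^ 2 * (16 * (2 * a) * (2 * (2 * a) + t)) ^ 2) ≤ n - 2 * a)
    {C : MonCircuit (Fin n × Fin n)} (hC : C.Computes (OddFactorProp n)) :
    2 ^ t ≤ 2 * (C.size * #(smallMatchings n (2 * a))) ∨ 4 ^ a ≤ 8 * C.size := by
  obtain ⟨hpos, hC⟩ := hC
  obtain ⟨N, P, hN, hP, happ⟩ := C.exists_approximates ha hn C.size le_rfl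
  obtain ⟨F, hF, hFapp⟩ := happ ⟨C.size - 1, by omega⟩ (by simp; omega)
  by_cases hempty : ∅ ∈ F
  · left
    have hodd : ({χ | Odd #{v | χ v = true}} : Finset (Fin n ⊕ Fin n → Bool)) ⊆ N := by
      intro χ hχ
      by_contra hχN
      exact not_oddFactorProp_monoGraph (mem_filter.1 hχ).2
        ((hC _).1 (hFapp.of_accepts χ hχN ⟨∅, hempty, by simp⟩))
    have hhalf := two_pow_le_two_mul_card_odd (Sum.inl ⟨0, hn₀⟩ : Fin n ⊕ Fin n)
    rw [Fintype.card_sum, Fintype.card_fin, ← two_mul] at hhalf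
    refine Nat.le_of_mul_le_mul_right (c := 2 ^ (2 * n)) ?_ (by positivity)
    calc 2 ^ t * 2 ^ (2 * n) ≤ 2 ^ t * (2 * #N) :=
          Nat.mul_le_mul_left _ (hhalf.trans (Nat.mul_le_mul_left _ (card_le_card hodd)))
      _ = 2 * (2 ^ t * #N) := by ring
      _ ≤ 2 * (C.size * (#(smallMatchings n (2 * a)) * 2 ^ (2 * n))) := Nat.mul_le_mul_left _ hN
      _ = _ := by ring
  · right
    have hacc := hF.card_perm_minimalMembers_le (by omega) hn 1
    have hcover : (univ : Finset (Equiv.Perm (Fin n))) ⊆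
        P ∪ univ.filter fun σ => ∃ M ∈ minimalMembers F, 1 ≤ #M ∧ ∀ e ∈ M, permGraph σ e = true := by
      intro σ _
      rw [mem_union, mem_filter]
      by_cases hσ : σ ∈ P
      · exact Or.inl hσ
      · obtain ⟨M, hM, hMσ⟩ := hFapp.accepts σ hσ ((hC _).2 (oddFactorProp_permGraph σ))
        obtain ⟨S, hS, hSM⟩ := exists_minimalMembers_subset hM
        refine Or.inr ⟨mem_univ _, S, hS, card_pos.2 (nonempty_iff_ne_empty.2 ?_),
          fun e he => hMσ e (hSM he)⟩
        rintro rfl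
        exact hempty (mem_filter.1 hS).1
    have hcard := (card_le_card hcover).trans (card_union_le _ _)
    rw [card_univ, Fintype.card_perm, Fintype.card_fin] at hcard
    have hhalf : n.factorial ≤ 2 * #P := by omega
    refine Nat.le_of_mul_le_mul_right (c := n.factorial) ?_ n.factorial_pos
    calc 4 ^ a * n.factorial ≤ 4 ^ a * (2 * #P) := Nat.mul_le_mul_left _ hhalf
      _ = 2 * (4 ^ a * #P) := by ring
      _ ≤ 2 * (C.size * (4 * n.factorial)) := Nat.mul_le_mul_left _ hP
      _ = _ := by ring

lemma MonCircuit.Computes.two_pow_le_size {a : ℕ} (ha : 0 < a) (hlow : 2 ^ 19 * (2 * a) ^ 8 ≤ n)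
    (hupp : n ≤ 2 ^ (2 * a)) {C : MonCircuit (Fin n × Fin n)} (hC : C.Computes (OddFactorProp n)) :
    2 ^ (2 * a) ≤ 8 * C.size := by
  obtain ⟨w, hw⟩ : ∃ w, w = 2 * a := ⟨_, rfl⟩
  have hw₁ : 1 ≤ w := by omega
  rw [← hw] at hlow hupp
  have hn₀ : 0 < n := lt_of_lt_of_le (by positivity) hlow
  have hbase : 4 * (8 * w ^ 2 * (16 * w * (2 * w + (2 * w ^ 2 + 2 * w + 1))) ^ 2) ≤ n - w := by
    have h₁ : 2 * w + (2 * w ^ 2 + 2 * w + 1) ≤ 7 * w ^ 2 := by nlinarith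
    have h₂ : w ≤ w ^ 8 := Nat.le_self_pow (by norm_num) w
    have h₃ : 4 * (8 * w ^ 2 * (16 * w * (2 * w + (2 * w ^ 2 + 2 * w + 1))) ^ 2) ≤
        4 * (8 * w ^ 2 * (16 * w * (7 * w ^ 2)) ^ 2) := by gcongr
    have h₄ : 4 * (8 * w ^ 2 * (16 * w * (7 * w ^ 2)) ^ 2) = 401408 * w ^ 8 := by ring
    omega
  rw [hw] at hbase
  rcases hC.size_bound ha hn₀ hbase with h | h
  · rw [← hw] at h ⊢
    have hsmall : #(smallMatchings n w) ≤ 2 ^ (2 * w ^ 2 + w) := by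
      refine (card_smallMatchings_le w hn₀).trans ?_
      calc (w + 1) * (n ^ 2) ^ w ≤ 2 ^ w * ((2 ^ w) ^ 2) ^ w :=
            Nat.mul_le_mul Nat.lt_two_pow_self (by gcongr)
        _ = 2 ^ (2 * w ^ 2 + w) := by ring
    have : 2 ^ w * 2 ^ (2 * w ^ 2 + w + 1) ≤ C.size * 2 ^ (2 * w ^ 2 + w + 1) :=
      calc 2 ^ w * 2 ^ (2 * w ^ 2 + w + 1) = 2 ^ (2 * w ^ 2 + 2 * w + 1) := by ring
        _ ≤ 2 * (C.size * 2 ^ (2 * w ^ 2 + w)) :=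
            h.trans (by gcongr)
        _ = _ := by ring
    have := Nat.le_of_mul_le_mul_right this (by positivity)
    omega
  · rwa [pow_mul]

end Matching

open Filter in
lemma eventually_exists_parameter : ∀ᶠ n : ℕ in atTop, ∃ a : ℕ, 0 < a ∧
    2 ^ 19 * (2 * a) ^ 8 ≤ n ∧ n ≤ 2 ^ (2 * a) ∧ (n : ℝ) ^ (1 / 20 : ℝ) + 3 ≤ 2 * a := by
  have hx : Tendsto (fun n : ℕ => (n : ℝ) ^ (1 / 20 : ℝ)) atTop atTop :=
    (tendsto_rpow_atTop (by norm_num)).comp tendsto_natCast_atTop_atTop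
  have hpow : ∀ᶠ x : ℝ in atTop, x ^ 20 ≤ 2 ^ x := by
    have h := (isLittleO_pow_exp_pos_mul_atTop 20 (Real.log_pos one_lt_two)).bound one_pos
    filter_upwards [h, eventually_ge_atTop 0] with x hx h₀
    rw [Real.rpow_def_of_pos two_pos]
    rwa [one_mul, Real.norm_of_nonneg (by positivity), Real.norm_of_nonneg (by positivity)] at hx
  filter_upwards [hx.eventually hpow, hx.eventually_ge_atTop 8] with n hxn h8
  have hn : ((n : ℝ) ^ (1 / 20 : ℝ)) ^ 20 = n := by
    rw [← Real.rpow_natCast, ← Real.rpow_mul n.cast_nonneg]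
    norm_num
  generalize (n : ℝ) ^ (1 / 20 : ℝ) = x at hxn h8 hn
  have hceil := Nat.le_ceil x
  have hceil' := Nat.ceil_lt_add_one (show 0 ≤ x by linarith)
  refine ⟨⌈x⌉₊ + 2, by omega, ?_, ?_, by push_cast; linarith⟩
  · have h : (2 * (⌈x⌉₊ + 2) : ℝ) ≤ 4 * x := by linarith
    rw [← Nat.cast_le (α := ℝ), ← hn]
    rw [Nat.cast_mul, Nat.cast_pow, Nat.cast_pow, Nat.cast_mul, Nat.cast_add]
    calc (2 : ℝ) ^ 19 * (2 * (⌈x⌉₊ + 2)) ^ 8 ≤ 2 ^ 19 * (4 * x) ^ 8 := by gcongr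
      _ = 8 ^ 11 * 4 * x ^ 8 := by ring
      _ ≤ x ^ 12 * x ^ 8 := by
        gcongr
        calc (8 : ℝ) ^ 11 * 4 ≤ 8 ^ 12 := by norm_num
          _ ≤ x ^ 12 := by gcongr
      _ = x ^ 20 := by ring
  · rw [← Nat.cast_le (α := ℝ), ← hn]
    push_cast
    rw [← Real.rpow_natCast 2]
    refine hxn.trans (Real.rpow_le_rpow_of_exponent_le one_le_two ?_)
    push_cast
    linarith

/-- There exist `c > 0` and `N` such that for all `n ≥ N`: every monotone circuit computing
`Odd_n` has size at least `2 ^ (n ^ c)`. -/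
theorem odd_factor_monotone_lower_bound :
    ∃ c : ℝ, 0 < c ∧ ∃ N : ℕ, ∀ n : ℕ, N ≤ n →
      ∀ C : MonCircuit (Fin n × Fin n), C.Computes (OddFactorProp n) →
        (2 : ℝ) ^ ((n : ℝ) ^ c) ≤ (C.size : ℝ) := by
  obtain ⟨N, hN⟩ := Filter.eventually_atTop.1 eventually_exists_parameter
  refine ⟨1 / 20, by norm_num, N, fun n hn C hC => ?_⟩
  obtain ⟨a, ha, hlow, hupp, hx⟩ := hN n hn
  have hsize : ((2 ^ (2 * a) : ℕ) : ℝ) ≤ (8 * C.size : ℕ) :=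
    Nat.cast_le.2 (hC.two_pow_le_size ha hlow hupp)
  push_cast at hsize
  have h : (2 : ℝ) ^ ((n : ℝ) ^ (1 / 20 : ℝ)) * 8 ≤ 2 ^ (2 * a) :=
    calc (2 : ℝ) ^ ((n : ℝ) ^ (1 / 20 : ℝ)) * 8 = 2 ^ ((n : ℝ) ^ (1 / 20 : ℝ) + 3) := by
          rw [Real.rpow_add two_pos]
          norm_num
      _ ≤ 2 ^ ((2 * a : ℕ) : ℝ) :=
          Real.rpow_le_rpow_of_exponent_le one_le_two (by exact_mod_cast hx)
      _ = 2 ^ (2 * a) := Real.rpow_natCast 2 (2 * a)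
  linarith
end

section
/- (Robust Sunflower Lemma) There exists a universal constant c > 0 such that for all n ≥ 1, ℓ ≥ 1 and all ε with 0 < ε < 1/2: every family S of ℓ-element subsets of Fin n with |S| ≥ (c · log(ℓ/ε))^ℓ contains a subfamily S' ⊆ S with |S'| ≥ 2 which is an ε-robust sunflower. -/
/-- A family `S'` of finite subsets of `Fin n` with `|S'| ≥ 2` and core `K = ⋂ S'` is an
`ε`-robust sunflower if for `x` sampled uniformly from `{0,1}^n`, the probability that some
`S ∈ S'` has `x_i = 1` for every `i ∈ S \ K` is at least `1 - ε`. -/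
def IsRobustSunflower (n : ℕ) (ε : ℝ) (𝓢 : Finset (Finset (Fin n))) : Prop :=
  2 ≤ 𝓢.card ∧
  1 - ε ≤
    (Nat.card {x : Fin n → Bool //
        ∃ S ∈ 𝓢, ∀ i ∈ S \ 𝓢.inf id, x i = true} : ℝ) / (2 : ℝ) ^ n

open Finset

section RobustSunflower

variable {α ι : Type*} [DecidableEq α]

/-- The expectation of `g W`, where `W` contains each element of `s` independently with
probability `p`. -/
noncomputable def biasedMean (s : Finset α) (p : ℝ) (g : Finset α → ℝ) : ℝ :=
  ∑ W ∈ s.powerset, p ^ #W * (1 - p) ^ #(s \ W) * g W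

theorem biasedMean_empty (p : ℝ) (g : Finset α → ℝ) : biasedMean ∅ p g = g ∅ := by
  simp [biasedMean]

theorem biasedMean_insert {a : α} {s : Finset α} (ha : a ∉ s) (p : ℝ) (g : Finset α → ℝ) :
    biasedMean (insert a s) p g =
      (1 - p) * biasedMean s p g + p * biasedMean s p (fun W => g (insert a W)) := by
  unfold biasedMean
  rw [sum_powerset_insert ha, mul_sum, mul_sum]
  congr 1
  · refine sum_congr rfl fun W hW => ?_
    have haW : a ∉ W := fun h => ha (mem_powerset.1 hW h)
    rw [insert_sdiff_of_notMem _ haW, card_insert_of_notMem (by simp [ha])]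
    ring
  · refine sum_congr rfl fun W hW => ?_
    have haW : a ∉ W := fun h => ha (mem_powerset.1 hW h)
    rw [insert_sdiff_insert, sdiff_insert_of_notMem ha, card_insert_of_notMem haW]
    ring

theorem biasedMean_linear (s : Finset α) (p a b : ℝ) (g h : Finset α → ℝ) :
    biasedMean s p (fun W => a * g W + b * h W) = a * biasedMean s p g + b * biasedMean s p h := by
  unfold biasedMean
  rw [mul_sum, mul_sum, ← sum_add_distrib]
  exact sum_congr rfl fun W _ => by ring

theorem biasedMean_const (s : Finset α) (p b : ℝ) : biasedMean s p (fun _ => b) = b := by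
  induction s using Finset.induction_on with
  | empty => simp [biasedMean_empty]
  | insert a s ha ih => rw [biasedMean_insert ha, ih]; ring

theorem biasedMean_const_mul (s : Finset α) (p a : ℝ) (g : Finset α → ℝ) :
    biasedMean s p (fun W => a * g W) = a * biasedMean s p g := by
  simpa using biasedMean_linear s p a 0 g g

theorem biasedMean_mono (s : Finset α) {p : ℝ} (h0 : 0 ≤ p) (h1 : p ≤ 1) {g h : Finset α → ℝ}
    (hgh : ∀ W, g W ≤ h W) : biasedMean s p g ≤ biasedMean s p h := by
  have : 0 ≤ 1 - p := by linarith
  exact sum_le_sum fun W _ => mul_le_mul_of_nonneg_left (hgh W) (by positivity)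

theorem biasedMean_zero (s : Finset α) (g : Finset α → ℝ) : biasedMean s 0 g = g ∅ := by
  induction s using Finset.induction_on with
  | empty => simp [biasedMean_empty]
  | insert a s ha ih => rw [biasedMean_insert ha, ih]; ring

theorem biasedMean_union (s : Finset α) (p q : ℝ) (g : Finset α → ℝ) :
    biasedMean s p (fun W => biasedMean s q fun V => g (W ∪ V)) =
      biasedMean s (1 - (1 - p) * (1 - q)) g := by
  induction s using Finset.induction_on generalizing g with
  | empty => simp [biasedMean_empty]
  | insert a s ha ih =>
    simp only [biasedMean_insert ha, biasedMean_linear, insert_union, union_insert,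
      insert_idem, ih]
    rw [ih (fun W => g (insert a W))]
    ring

theorem exists_fragment (f : ι → Finset α) (W : Finset α) (i : ι) :
    ∃ M : Finset α, (∃ j, #(f j) ≤ #(f i) ∧ f j ⊆ W ∪ f i ∧ M = f j \ W) ∧
      ∀ j, #(f j) ≤ #(f i) → f j ⊆ W ∪ f i → #M ≤ #(f j \ W) := by
  obtain ⟨j, hj, hmin⟩ := exists_minimalFor_of_wellFoundedLT
    (fun j => #(f j) ≤ #(f i) ∧ f j ⊆ W ∪ f i) (fun j => #(f j \ W))
    ⟨i, le_rfl, subset_union_right⟩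
  refine ⟨f j \ W, ⟨j, hj.1, hj.2, rfl⟩, fun k h1 h2 => ?_⟩
  rcases le_total #(f j \ W) #(f k \ W) with h | h
  · exact h
  · exact hmin ⟨h1, h2⟩ h

/-- A smallest set of the form `f j \ W` with `f j ⊆ W ∪ f i` and `#(f j) ≤ #(f i)`. -/
noncomputable def fragment (f : ι → Finset α) (W : Finset α) (i : ι) : Finset α :=
  (exists_fragment f W i).choose

theorem fragment_eq (f : ι → Finset α) (W : Finset α) (i : ι) :
    ∃ j, #(f j) ≤ #(f i) ∧ f j ⊆ W ∪ f i ∧ fragment f W i = f j \ W :=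
  (exists_fragment f W i).choose_spec.1

theorem card_fragment_le {f : ι → Finset α} {W : Finset α} {i j : ι} (h : #(f j) ≤ #(f i))
    (hsub : f j ⊆ W ∪ f i) : #(fragment f W i) ≤ #(f j \ W) :=
  (exists_fragment f W i).choose_spec.2 j h hsub

theorem fragment_subset (f : ι → Finset α) (W : Finset α) (i : ι) : fragment f W i ⊆ f i := by
  obtain ⟨j, -, h, he⟩ := fragment_eq f W i
  rw [he]
  exact sdiff_le_iff.2 h

theorem fragment_disjoint (f : ι → Finset α) (W : Finset α) (i : ι) :
    Disjoint (fragment f W i) W := by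
  obtain ⟨j, -, -, he⟩ := fragment_eq f W i
  rw [he]
  exact sdiff_disjoint

/-- The fragment of `i` lies in every sufficiently small `f j` covered by `W` and the fragment. -/
theorem fragment_subset_of_subset_union {f : ι → Finset α} {W : Finset α} {i j : ι}
    (h : #(f j) ≤ #(f i)) (hsub : f j ⊆ W ∪ fragment f W i) : fragment f W i ⊆ f j := by
  have hle := card_fragment_le h (hsub.trans (union_subset_union_right (fragment_subset f W i)))
  rw [← eq_of_subset_of_card_le (sdiff_le_iff.2 hsub) hle]
  exact sdiff_subset

/-- A family of sets indexed by `ι` is `r`-spread if each `T` lies in at most an `r ^ (-#T)`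
proportion of the sets. -/
def IsSpread [Fintype ι] (r : ℝ) (f : ι → Finset α) : Prop :=
  ∀ T : Finset α, (#{i | T ⊆ f i} : ℝ) * r ^ #T ≤ Fintype.card ι

theorem IsSpread.fragments [Fintype ι] {r : ℝ} (hr : 0 ≤ r) {f : ι → Finset α}
    (hf : IsSpread r f) (W : Finset α) : IsSpread r (fragment f W) := fun T => by
  refine le_trans ?_ (hf T)
  gcongr with i
  exact fragment_subset f W i

theorem weight_sdiff_le [Fintype α] {p : ℝ} (h0 : 0 < p) (h1 : p ≤ 1) {M Z : Finset α}
    (h : M ⊆ Z) :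
    p ^ #(Z \ M) * (1 - p) ^ #(univ \ (Z \ M)) ≤ p ^ #Z * (1 - p) ^ #(univ \ Z) / p ^ #M := by
  have hq : 0 ≤ 1 - p := by linarith
  rw [le_div_iff₀ (by positivity)]
  have e1 : #Z = #(Z \ M) + #M := (card_sdiff_add_card_eq_card h).symm
  have e2 : #(univ \ Z) ≤ #(univ \ (Z \ M)) := card_le_card (sdiff_subset_sdiff le_rfl sdiff_subset)
  rw [e1, pow_add]
  have := pow_le_pow_of_le_one hq (by linarith) e2
  calc _ = p ^ #(Z \ M) * p ^ #M * (1 - p) ^ #(univ \ (Z \ M)) := by ring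
    _ ≤ _ := by gcongr

/-- Few pairs `(W, i)` with `#(f i) = k` have a fragment with more than `k / 2` elements. -/
theorem biasedMean_card_large_fragment_le [Fintype α] [Fintype ι] {p r : ℝ} (h0 : 0 < p)
    (h1 : p ≤ 1) (hr : 0 < r) (hpr : 256 ≤ p * r) {f : ι → Finset α} (hf : IsSpread r f) (k : ℕ) :
    biasedMean univ p (fun W => (#{i | #(f i) = k ∧ k < 2 * #(fragment f W i)} : ℝ)) ≤
      Fintype.card ι * (1 / 8) ^ k := by
  have hq : 0 ≤ 1 - p := by linarith
  set μ : Finset α → ℝ := fun W => p ^ #W * (1 - p) ^ #(univ \ W) with hμ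
  have hμ0 : ∀ W, 0 ≤ μ W := fun W => by simp only [hμ]; positivity
  have hcover : ∀ Z : Finset α, ∃ X : Finset α, #X ≤ k ∧
      ∀ W i, #(f i) = k → W ∪ fragment f W i = Z → fragment f W i ⊆ X := by
    intro Z
    by_cases hZ : ∃ j, #(f j) ≤ k ∧ f j ⊆ Z
    · obtain ⟨j, hj, hjZ⟩ := hZ
      exact ⟨f j, hj, fun W i hi hWZ =>
        fragment_subset_of_subset_union (hi ▸ hj) (hWZ ▸ hjZ)⟩
    · refine ⟨∅, by simp, fun W i hi hWZ => (hZ ?_).elim⟩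
      obtain ⟨j, hj, -, he⟩ := fragment_eq f W i
      refine ⟨j, hi ▸ hj, ?_⟩
      rw [← hWZ, he]
      simp
  choose X hXk hX using hcover
  set P : Finset (Finset α × ι) :=
    {x | #(f x.2) = k ∧ k < 2 * #(fragment f x.1 x.2)} with hP
  set Q : Finset ((Finset α × Finset α) × ι) :=
    {y | y.1.2 ⊆ y.1.1 ∧ y.1.2 ⊆ X y.1.1 ∧ k < 2 * #y.1.2 ∧ y.1.2 ⊆ f y.2} with hQ
  let e : Finset α × ι → (Finset α × Finset α) × ι :=
    fun x => ((x.1 ∪ fragment f x.1 x.2, fragment f x.1 x.2), x.2)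
  have hsd : ∀ x : Finset α × ι, (e x).1.1 \ (e x).1.2 = x.1 := fun x =>
    union_sdiff_cancel_right (fragment_disjoint f x.1 x.2).symm
  have heinj : Function.Injective e := fun x y h => by
    refine Prod.ext ?_ (congrArg (fun y => y.2) h)
    rw [← hsd x, ← hsd y, h]
  have hePQ : P.map ⟨e, heinj⟩ ⊆ Q := by
    intro y hy
    obtain ⟨x, hx, rfl⟩ := mem_map.1 hy
    simp only [hP, mem_filter, mem_univ, true_and] at hx
    simp only [hQ, mem_filter, mem_univ, true_and]
    exact ⟨subset_union_right, hX _ _ _ hx.1 rfl, hx.2, fragment_subset f _ _⟩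
  have hterm : ∀ Z M : Finset α, M ⊆ Z → k < 2 * #M →
      μ (Z \ M) * #{i | M ⊆ f i} ≤ μ Z * (Fintype.card ι * (1 / 16) ^ k) := by
    intro Z M hMZ hkM
    have hs : (#{i | M ⊆ f i} : ℝ) ≤ Fintype.card ι / r ^ #M := by
      rw [le_div_iff₀ (by positivity)]
      exact hf M
    have hpow : (16 : ℝ) ^ k ≤ (p * r) ^ #M := by
      calc (16 : ℝ) ^ k ≤ 16 ^ (2 * #M) := pow_le_pow_right₀ (by norm_num) hkM.le
        _ = 256 ^ #M := by rw [pow_mul]; norm_num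
        _ ≤ _ := by gcongr
    calc μ (Z \ M) * #{i | M ⊆ f i} ≤ μ Z / p ^ #M * (Fintype.card ι / r ^ #M) :=
          mul_le_mul (weight_sdiff_le h0 h1 hMZ) hs (by positivity)
            (div_nonneg (hμ0 Z) (by positivity))
      _ = μ Z * (Fintype.card ι * (1 / (p * r) ^ #M)) := by
          rw [mul_pow]; field_simp
      _ ≤ μ Z * (Fintype.card ι * (1 / 16 ^ k)) := by
          have := hμ0 Z
          gcongr
      _ = _ := by rw [one_div_pow]
  calc biasedMean univ p (fun W => (#{i | #(f i) = k ∧ k < 2 * #(fragment f W i)} : ℝ))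
      = ∑ x ∈ P, μ x.1 := by
        rw [hP, sum_filter, Fintype.sum_prod_type]
        simp only [biasedMean, powerset_univ, card_filter, Nat.cast_sum, mul_sum]
        refine sum_congr rfl fun W _ => sum_congr rfl fun i _ => ?_
        split_ifs <;> simp [hμ]
    _ = ∑ y ∈ P.map ⟨e, heinj⟩, μ (y.1.1 \ y.1.2) := by
        rw [sum_map]
        exact sum_congr rfl fun x _ => congrArg μ (hsd x).symm
    _ ≤ ∑ y ∈ Q, μ (y.1.1 \ y.1.2) := sum_le_sum_of_subset_of_nonneg hePQ fun _ _ _ => hμ0 _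
    _ = ∑ Z, ∑ M with M ⊆ Z ∧ M ⊆ X Z ∧ k < 2 * #M, μ (Z \ M) * #{i | M ⊆ f i} := by
        rw [hQ, sum_filter, Fintype.sum_prod_type, Fintype.sum_prod_type]
        refine sum_congr rfl fun Z _ => ?_
        rw [sum_filter]
        refine sum_congr rfl fun M _ => ?_
        split_ifs with h
        · rw [card_filter, Nat.cast_sum, mul_sum]
          refine sum_congr rfl fun i _ => ?_
          by_cases hi : M ⊆ f i <;> simp [h, hi]
        · refine sum_eq_zero fun i _ => if_neg fun h' => h ⟨h'.1, h'.2.1, h'.2.2.1⟩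
    _ ≤ ∑ Z, ∑ M with M ⊆ Z ∧ M ⊆ X Z ∧ k < 2 * #M,
          μ Z * (Fintype.card ι * (1 / 16) ^ k) := by
        refine sum_le_sum fun Z _ => sum_le_sum fun M hM => ?_
        simp only [mem_filter, mem_univ, true_and] at hM
        exact hterm Z M hM.1 hM.2.2
    _ ≤ ∑ Z, μ Z * (Fintype.card ι * (1 / 8) ^ k) := by
        refine sum_le_sum fun Z _ => ?_
        rw [sum_const, nsmul_eq_mul]
        have hcard : #{M | M ⊆ Z ∧ M ⊆ X Z ∧ k < 2 * #M} ≤ 2 ^ k := by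
          calc _ ≤ #(X Z).powerset := card_le_card fun M hM => by
                simp only [mem_filter] at hM
                exact mem_powerset.2 hM.2.2.1
            _ = 2 ^ #(X Z) := card_powerset _
            _ ≤ 2 ^ k := Nat.pow_le_pow_right (by norm_num) (hXk Z)
        have hcard' : (#{M | M ⊆ Z ∧ M ⊆ X Z ∧ k < 2 * #M} : ℝ) ≤ 2 ^ k := by exact_mod_cast hcard
        have := hμ0 Z
        calc _ ≤ (2 : ℝ) ^ k * (μ Z * (Fintype.card ι * (1 / 16) ^ k)) := by gcongr
          _ = μ Z * (Fintype.card ι * (2 * (1 / 16)) ^ k) := by rw [mul_pow]; ring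
          _ = _ := by norm_num
    _ = biasedMean (univ : Finset α) p (fun _ => Fintype.card ι * (1 / 8) ^ k) := by
        simp [biasedMean, hμ]
    _ = _ := biasedMean_const _ _ _

theorem sum_range_mul_inv_eight_pow_le (K : ℕ) :
    ∑ k ∈ range K, (k : ℝ) * (1 / 8) ^ k ≤ 1 / 4 := by
  have h : ∑ k ∈ range K, (k : ℝ) * (1 / 8) ^ k = 8 / 49 - (8 / 7 * K + 8 / 49) * (1 / 8) ^ K := by
    induction K with
    | zero => simp
    | succ K ih => rw [sum_range_succ, ih]; push_cast; ring
  have : (0 : ℝ) ≤ (8 / 7 * K + 8 / 49) * (1 / 8) ^ K := by positivity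
  rw [h]
  linarith

/-- Passing to fragments shrinks the expected total size of a spread family by a constant
factor. -/
theorem biasedMean_sum_card_fragment_le [Fintype α] [Fintype ι] {p r : ℝ} (h0 : 0 < p)
    (h1 : p ≤ 1) (hr : 0 < r) (hpr : 256 ≤ p * r) {f : ι → Finset α} (hf : IsSpread r f) :
    biasedMean univ p (fun W => ∑ i, (#(fragment f W i) : ℝ)) ≤ 3 / 4 * ∑ i, (#(f i) : ℝ) := by
  by_cases hempty : ∃ j, f j = ∅
  · obtain ⟨j, hj⟩ := hempty
    have hz : ∀ W i, #(fragment f W i) = 0 := fun W i => by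
      simpa [hj] using card_fragment_le (f := f) (W := W) (i := i) (j := j) (by simp [hj])
        (by simp [hj])
    simp only [hz, Nat.cast_zero, sum_const_zero, biasedMean_const]
    positivity
  · push Not at hempty
    have hN : (Fintype.card ι : ℝ) ≤ ∑ i, (#(f i) : ℝ) := by
      calc (Fintype.card ι : ℝ) = ∑ _i : ι, (1 : ℝ) := by simp
        _ ≤ _ := sum_le_sum fun i _ => by
          exact_mod_cast Finset.card_pos.2 (hempty i)
    set K := Fintype.card α + 1
    set c : ℕ → Finset α → ℝ := fun k W => #{i | #(f i) = k ∧ k < 2 * #(fragment f W i)}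
    have hpt : ∀ W, ∑ i, (#(fragment f W i) : ℝ) ≤
        1 / 2 * ∑ i, (#(f i) : ℝ) + 1 * ∑ k ∈ range K, (k : ℝ) * c k W := by
      intro W
      have hswap : ∑ k ∈ range K, (k : ℝ) * c k W =
          ∑ i, if #(f i) < 2 * #(fragment f W i) then (#(f i) : ℝ) else 0 := by
        simp only [c, card_filter, Nat.cast_sum, mul_sum]
        rw [sum_comm]
        refine sum_congr rfl fun i _ => ?_
        rw [sum_eq_single #(f i)]
        · split_ifs <;> simp_all
        · intro k _ hk
          simp [hk.symm]
        · intro h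
          exact (h (mem_range.2 (Nat.lt_succ_of_le (card_le_univ _)))).elim
      rw [hswap, one_mul, mul_sum, ← sum_add_distrib]
      refine sum_le_sum fun i _ => ?_
      have hle : (#(fragment f W i) : ℝ) ≤ #(f i) := by
        exact_mod_cast card_le_card (fragment_subset f W i)
      split_ifs with h
      · have : (0 : ℝ) ≤ #(f i) := by positivity
        linarith
      · have : (2 * #(fragment f W i) : ℝ) ≤ #(f i) := by exact_mod_cast not_lt.1 h
        linarith
    have hsum : biasedMean univ p (fun W => ∑ k ∈ range K, (k : ℝ) * c k W) ≤
        1 / 4 * Fintype.card ι := by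
      calc _ = ∑ k ∈ range K, (k : ℝ) * biasedMean univ p (c k) := by
            unfold biasedMean
            simp only [mul_sum]
            rw [sum_comm]
            exact sum_congr rfl fun k _ => sum_congr rfl fun W _ => by ring
        _ ≤ ∑ k ∈ range K, (k : ℝ) * (Fintype.card ι * (1 / 8) ^ k) := by
            gcongr with k
            exact biasedMean_card_large_fragment_le h0 h1 hr hpr hf k
        _ = (∑ k ∈ range K, (k : ℝ) * (1 / 8) ^ k) * Fintype.card ι := by
            rw [sum_mul]
            exact sum_congr rfl fun k _ => by ring
        _ ≤ _ := by
            gcongr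
            exact sum_range_mul_inv_eight_pow_le K
    calc _ ≤ _ := biasedMean_mono univ h0.le h1 hpt
      _ = 1 / 2 * ∑ i, (#(f i) : ℝ) +
          1 * biasedMean univ p (fun W => ∑ k ∈ range K, (k : ℝ) * c k W) := by
          rw [biasedMean_linear, biasedMean_const]
      _ ≤ _ := by linarith

open Classical in
/-- The indicator of the event that `W` contains no member of the family `f`. -/
noncomputable def missIndicator (f : ι → Finset α) (W : Finset α) : ℝ :=
  if ∃ i, f i ⊆ W then 0 else 1

theorem missIndicator_union_le (f : ι → Finset α) (W V : Finset α) :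
    missIndicator f (W ∪ V) ≤ missIndicator (fragment f W) V := by
  unfold missIndicator
  by_cases h : ∃ i, fragment f W i ⊆ V
  · have h' : ∃ i, f i ⊆ W ∪ V := by
      obtain ⟨i, hi⟩ := h
      obtain ⟨j, -, -, he⟩ := fragment_eq f W i
      exact ⟨j, sdiff_le_iff.1 (he ▸ hi)⟩
    simp [h, h']
  · rw [if_neg h]
    split_ifs <;> norm_num

/-- After `m` rounds of `p`-random exposure, the probability of not covering any member of a
spread family decays geometrically in `m`. -/
theorem IsSpread.biasedMean_missIndicator_le [Fintype α] [Fintype ι] {p r : ℝ} (h0 : 0 < p)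
    (h1 : p ≤ 1) (hr : 0 < r) (hpr : 256 ≤ p * r) (m : ℕ) {f : ι → Finset α}
    (hf : IsSpread r f) :
    Fintype.card ι * biasedMean univ (1 - (1 - p) ^ m) (missIndicator f) ≤
      (3 / 4) ^ m * ∑ i, (#(f i) : ℝ) := by
  induction m generalizing f with
  | zero =>
    simp only [pow_zero, sub_self, biasedMean_zero, one_mul, missIndicator]
    split_ifs with h
    · rw [mul_zero]; positivity
    · rw [mul_one]
      push Not at h
      calc (Fintype.card ι : ℝ) = ∑ _i : ι, (1 : ℝ) := by simp
        _ ≤ _ := sum_le_sum fun i _ => by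
          have := h i
          rw [subset_empty] at this
          exact_mod_cast Finset.card_pos.2 (nonempty_iff_ne_empty.2 this)
  | succ m ih =>
    have hq : 0 ≤ (1 - p) ^ m := pow_nonneg (by linarith) m
    have hq1 : (1 - p) ^ m ≤ 1 := pow_le_one₀ (by linarith) (by linarith)
    have hs : 1 - (1 - p) ^ (m + 1) = 1 - (1 - p) * (1 - (1 - (1 - p) ^ m)) := by ring
    rw [hs, ← biasedMean_union, ← biasedMean_const_mul]
    calc _ ≤ biasedMean univ p
          (fun W => (3 / 4) ^ m * ∑ i, (#(fragment f W i) : ℝ)) := by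
          refine biasedMean_mono univ h0.le h1 fun W => ?_
          refine le_trans ?_ (ih (hf.fragments hr.le W))
          gcongr
          exact biasedMean_mono univ (by linarith) (by linarith) fun V =>
            missIndicator_union_le f W V
      _ = (3 / 4) ^ m * biasedMean univ p (fun W => ∑ i, (#(fragment f W i) : ℝ)) :=
          biasedMean_const_mul _ _ _ _
      _ ≤ (3 / 4) ^ m * (3 / 4 * ∑ i, (#(f i) : ℝ)) := by
          gcongr
          exact biasedMean_sum_card_fragment_le h0 h1 hr hpr hf
      _ = _ := by ring

/-- A uniformly random set contains a member of a `512 m`-spread family of sets of size at most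
`ℓ`, except with probability `(3 / 4) ^ m * ℓ`. -/
theorem IsSpread.biasedMean_half_missIndicator_le [Fintype α] [Fintype ι] [Nonempty ι] {m ℓ : ℕ}
    (hm : 1 ≤ m) {f : ι → Finset α} (hf : IsSpread (512 * m) f) (hℓ : ∀ i, #(f i) ≤ ℓ) :
    biasedMean univ (1 / 2) (missIndicator f) ≤ (3 / 4) ^ m * ℓ := by
  have hm0 : (0 : ℝ) < m := by exact_mod_cast hm
  have hm1 : (1 : ℝ) ≤ m := by exact_mod_cast hm
  obtain ⟨q, hq0, hqm⟩ : ∃ q : ℝ, 0 ≤ q ∧ q ^ m = 1 / 2 :=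
    ⟨(1 / 2 : ℝ) ^ ((m : ℝ)⁻¹), by positivity,
      Real.rpow_inv_natCast_pow (by norm_num) (by omega)⟩
  have hq : q ≤ 1 - 1 / (2 * m) := by
    refine le_of_pow_le_pow_left₀ (n := m) (by omega) ?_ ?_
    · rw [sub_nonneg, div_le_one (by positivity)]
      linarith
    · have hb := one_add_mul_le_pow (a := -(1 / (2 * (m : ℝ)))) (by
        have : 1 / (2 * (m : ℝ)) ≤ 1 := by rw [div_le_one (by positivity)]; linarith
        linarith) m
      have e : 1 + (m : ℝ) * -(1 / (2 * (m : ℝ))) = 1 / 2 := by field_simp; norm_num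
      rw [hqm, sub_eq_add_neg]
      linarith
  have hp : 1 / (2 * (m : ℝ)) ≤ 1 - q := by linarith
  have hp0 : (0 : ℝ) < 1 / (2 * (m : ℝ)) := by positivity
  have h := hf.biasedMean_missIndicator_le (p := 1 - q) (by linarith) (by linarith)
    (by positivity) (by
      calc (256 : ℝ) = 1 / (2 * m) * (512 * m) := by field_simp; norm_num
        _ ≤ _ := by gcongr) m
  rw [sub_sub_cancel, hqm, show (1 : ℝ) - 1 / 2 = 1 / 2 by norm_num] at h
  have hN : (0 : ℝ) < Fintype.card ι := by exact_mod_cast Fintype.card_pos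
  have hsum : ∑ i, (#(f i) : ℝ) ≤ Fintype.card ι * ℓ := by
    calc _ ≤ ∑ _i : ι, (ℓ : ℝ) := sum_le_sum fun i _ => by exact_mod_cast hℓ i
      _ = _ := by simp
  refine le_of_mul_le_mul_left (h.trans ?_) hN
  calc _ ≤ (3 / 4 : ℝ) ^ m * (Fintype.card ι * ℓ) := by gcongr
    _ = _ := by ring

/-- A large uniform family has a subfamily, given by the members containing some `K`, whose link
at `K` is spread. -/
theorem exists_spread_link_s3 [Fintype α] {r : ℝ} (hr : 1 ≤ r) {ℓ : ℕ} {𝓢 : Finset (Finset α)}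
    (hcard : ∀ S ∈ 𝓢, #S = ℓ) (hlt : r ^ ℓ < #𝓢) :
    ∃ K : Finset α, 2 ≤ #{S ∈ 𝓢 | K ⊆ S} ∧
      IsSpread r (fun S : {S // S ∈ 𝓢.filter (K ⊆ ·)} => S.1 \ K) := by
  have hr0 : 0 < r := by linarith
  obtain ⟨K, hK, hmax⟩ := exists_maximalFor_of_wellFoundedGT
    (fun K : Finset α => #K ≤ ℓ ∧ r ^ (ℓ - #K) < #{S ∈ 𝓢 | K ⊆ S}) id
    ⟨∅, by simp, by simpa using hlt⟩
  refine ⟨K, ?_, fun T => ?_⟩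
  · have : (1 : ℝ) < #{S ∈ 𝓢 | K ⊆ S} := (one_le_pow₀ hr).trans_lt hK.2
    exact_mod_cast this
  · rw [Fintype.card_coe]
    have hcount : #{S : {S // S ∈ 𝓢.filter (K ⊆ ·)} | T ⊆ S.1 \ K} =
        #{S ∈ 𝓢 | K ⊆ S ∧ T ⊆ S \ K} := by
      rw [← card_map (Function.Embedding.subtype _)]
      congr 1
      ext S
      simp only [mem_map, mem_filter, mem_univ, true_and, Function.Embedding.coe_subtype,
        Subtype.exists, exists_and_right, exists_eq_right]
      constructor
      · rintro ⟨⟨h1, h2⟩, h3⟩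
        exact ⟨h1, h2, h3⟩
      · rintro ⟨h1, h2, h3⟩
        exact ⟨⟨h1, h2⟩, h3⟩
    rw [hcount]
    rcases T.eq_empty_or_nonempty with rfl | hT
    · simp
    by_cases hd : Disjoint K T
    · by_cases hz : #{S ∈ 𝓢 | K ⊆ S ∧ T ⊆ S \ K} = 0
      · rw [hz]
        simp
      have hsub : #{S ∈ 𝓢 | K ⊆ S ∧ T ⊆ S \ K} ≤ #{S ∈ 𝓢 | K ∪ T ⊆ S} := by
        refine card_le_card fun S hS => ?_
        simp only [mem_filter] at hS ⊢
        exact ⟨hS.1, union_subset hS.2.1 (hS.2.2.trans sdiff_subset)⟩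
      obtain ⟨S, hS⟩ := card_pos.1 ((Nat.pos_of_ne_zero hz).trans_le hsub)
      rw [mem_filter] at hS
      have hKT : #(K ∪ T) ≤ ℓ := hcard S hS.1 ▸ card_le_card hS.2
      have hnot : ¬ r ^ (ℓ - #(K ∪ T)) < #{S ∈ 𝓢 | K ∪ T ⊆ S} := fun h => by
        have hle : K ∪ T ⊆ K := hmax ⟨hKT, h⟩ subset_union_left
        obtain ⟨t, ht⟩ := hT
        exact disjoint_left.1 hd (hle (mem_union_right _ ht)) ht
      rw [card_union_of_disjoint hd] at hKT hnot
      calc (#{S ∈ 𝓢 | K ⊆ S ∧ T ⊆ S \ K} : ℝ) * r ^ #T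
          ≤ #{S ∈ 𝓢 | K ∪ T ⊆ S} * r ^ #T := by gcongr
        _ ≤ r ^ (ℓ - (#K + #T)) * r ^ #T := by gcongr; exact not_lt.1 hnot
        _ = r ^ (ℓ - #K) := by rw [← pow_add]; congr 1; omega
        _ ≤ _ := hK.2.le
    · have hz : #{S ∈ 𝓢 | K ⊆ S ∧ T ⊆ S \ K} = 0 := by
        rw [card_eq_zero, filter_eq_empty_iff]
        rintro S - ⟨-, h⟩
        exact hd (disjoint_of_subset_right h disjoint_sdiff)
      rw [hz]
      simp

/-- If `K` is contained in all members of `𝓢`, it may replace the core of `𝓢` in the lower bound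
on the covering probability. -/
theorem one_sub_biasedMean_missIndicator_le {n : ℕ} {𝓢 : Finset (Finset (Fin n))}
    {K : Finset (Fin n)} (hK : ∀ S ∈ 𝓢, K ⊆ S) :
    1 - biasedMean univ (1 / 2) (missIndicator (fun S : {S // S ∈ 𝓢} => S.1 \ K)) ≤
      (Nat.card {x : Fin n → Bool //
        ∃ S ∈ 𝓢, ∀ i ∈ S \ 𝓢.inf id, x i = true} : ℝ) / (2 : ℝ) ^ n := by
  classical
  set f : {S // S ∈ 𝓢} → Finset (Fin n) := fun S => S.1 \ K
  have hcore : K ⊆ 𝓢.inf id := Finset.le_inf hK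
  have hcard : #{W : Finset (Fin n) | ∃ S, f S ⊆ W} ≤
      Nat.card {x : Fin n → Bool // ∃ S ∈ 𝓢, ∀ i ∈ S \ 𝓢.inf id, x i = true} := by
    rw [Nat.card_eq_fintype_card, Fintype.card_subtype]
    refine card_le_card_of_injOn (fun W i => decide (i ∈ W)) ?_ ?_
    · intro W hW
      simp only [coe_filter, mem_univ, true_and, Set.mem_ofPred_eq] at hW ⊢
      obtain ⟨S, hS⟩ := hW
      exact ⟨S.1, S.2, fun i hi => decide_eq_true (hS (sdiff_subset_sdiff le_rfl hcore hi))⟩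
    · intro W _ V _ h
      ext i
      simpa using congrFun h i
  have hmean : 1 - biasedMean univ (1 / 2) (missIndicator f) =
      (#{W : Finset (Fin n) | ∃ S, f S ⊆ W} : ℝ) / 2 ^ n := by
    have hw : ∀ W : Finset (Fin n),
        (1 / 2 : ℝ) ^ #W * (1 - 1 / 2) ^ #(univ \ W) = 1 / 2 ^ n := fun W => by
      rw [show (1 : ℝ) - 1 / 2 = 1 / 2 by norm_num, ← pow_add, add_comm,
        card_sdiff_add_card_eq_card (subset_univ W), card_univ, Fintype.card_fin, one_div_pow]
    have hone := biasedMean_const (univ : Finset (Fin n)) (1 / 2) 1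
    nth_rw 1 [← hone]
    simp only [biasedMean, hw, ← sum_sub_distrib, powerset_univ, card_filter, Nat.cast_sum,
      sum_div]
    refine sum_congr rfl fun W _ => ?_
    unfold missIndicator
    split_ifs <;> simp
  rw [hmean]
  gcongr

end RobustSunflower

/-- Robust Sunflower Lemma: there is a universal constant `c > 0` such that for all
`n, ℓ ≥ 1` and `0 < ε < 1/2`, every family of `ℓ`-element subsets of `Fin n` of size at least
`(c · log(ℓ/ε))^ℓ` contains a subfamily of size at least 2 that is an `ε`-robust sunflower. -/
theorem robust_sunflower_lemma :
    ∃ c : ℝ, 0 < c ∧ ∀ n ℓ : ℕ, 1 ≤ n → 1 ≤ ℓ → ∀ ε : ℝ, 0 < ε → ε < 1 / 2 →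
      ∀ 𝓢 : Finset (Finset (Fin n)), (∀ S ∈ 𝓢, S.card = ℓ) →
        (c * Real.log ((ℓ : ℝ) / ε)) ^ ℓ ≤ (𝓢.card : ℝ) →
        ∃ 𝓢' ⊆ 𝓢, IsRobustSunflower n ε 𝓢' := by
  refine ⟨4000, by norm_num, fun n ℓ _ hℓ ε hε0 hε 𝓢 hcard hlarge => ?_⟩
  have hℓ1 : (1 : ℝ) ≤ ℓ := by exact_mod_cast hℓ
  set L := Real.log ((ℓ : ℝ) / ε) with hL
  have hratio : (2 : ℝ) ≤ ℓ / ε := by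
    rw [le_div_iff₀ hε0]
    linarith
  have hL2 : 1 / 2 ≤ L := by
    have h1 := Real.log_two_gt_d9
    have h2 : Real.log 2 ≤ L := Real.log_le_log (by norm_num) hratio
    linarith
  set m := ⌈4 * L⌉₊
  have hmL : 4 * L ≤ m := Nat.le_ceil _
  have hmU : (m : ℝ) < 4 * L + 1 := Nat.ceil_lt_add_one (by linarith)
  have hm1 : 1 ≤ m := Nat.one_le_ceil_iff.2 (by linarith)
  have hm1' : (1 : ℝ) ≤ m := by exact_mod_cast hm1
  have hlt : (512 * m : ℝ) ^ ℓ < #𝓢 :=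
    (pow_lt_pow_left₀ (by linarith) (by positivity) (by omega)).trans_le hlarge
  have hdecay : (3 / 4 : ℝ) ^ m * ℓ ≤ ε := by
    have h34 : (3 / 4 : ℝ) ≤ Real.exp (-(1 / 4)) := by
      have := Real.add_one_le_exp (-(1 / 4 : ℝ))
      linarith
    have hexp : (3 / 4 : ℝ) ^ m ≤ ε / ℓ := by
      calc (3 / 4 : ℝ) ^ m ≤ Real.exp (-(1 / 4)) ^ m := by gcongr
        _ = Real.exp (m * -(1 / 4)) := (Real.exp_nat_mul _ _).symm
        _ ≤ Real.exp (-L) := Real.exp_le_exp.2 (by linarith)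
        _ = ε / ℓ := by rw [Real.exp_neg, hL, Real.exp_log (by linarith), inv_div]
    rwa [le_div_iff₀ (by linarith)] at hexp
  obtain ⟨K, htwo, hspread⟩ := exists_spread_link_s3 (by linarith) hcard hlt
  refine ⟨𝓢.filter (K ⊆ ·), filter_subset _ _, htwo, ?_⟩
  have : Nonempty {S // S ∈ 𝓢.filter (K ⊆ ·)} := by
    obtain ⟨S, hS⟩ := card_pos.1 (lt_of_lt_of_le two_pos htwo)
    exact ⟨⟨S, hS⟩⟩
  have hmiss := hspread.biasedMean_half_missIndicator_le hm1 (ℓ := ℓ) fun S =>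
    (card_le_card sdiff_subset).trans (hcard S.1 (mem_filter.1 S.2).1).le
  have hcover := one_sub_biasedMean_missIndicator_le (𝓢 := 𝓢.filter (K ⊆ ·)) (K := K)
    fun S hS => (mem_filter.1 hS).2
  linarith
end
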